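/- arXiv:1606.05207 — 3 statements merged into one kernel-verified Lean document; each statement's English description precedes it below -/
import Mathlib

section
/- Let a ∈ C²([x_d,1]) with 0 < τ_os ≤ a(x) ≤ M_os, set β(x) := −(1/(2 a(x)^{1/4})) · (d²/dx²)(a(x)^{−1/4}), and let ε > 0. Let U : [x_d,1] → ℂ² solve the linear system U'(x) = [ (1/ε) A₀(x) + ε A₁(x) ] U(x), where A₀(x) = √(a(x)) · [[0,1],[−1,0]] and A₁(x) = [[0,0],[2β(x),0]]. Then for all x ∈ [x_d,1], in the Euclidean norm, ‖U(x_d)‖ · exp(−ε ∫_{x_d}^x |β(y)| dy) ≤ ‖U(x)‖ ≤ ‖U(x_d)‖ · exp(ε ∫_{x_d}^x |β(y)| dy). -/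
open MeasureTheory Set intervalIntegral

noncomputable section

/-- Two-sided Grönwall inequality with a continuous variable rate. -/
theorem gronwall_two_sided {c d : ℝ} {N N' b : ℝ → ℝ}
    (hb : ContinuousOn b (Icc c d))
    (hN : ∀ x ∈ Icc c d, HasDerivWithinAt N (N' x) (Icc c d) x)
    (hle : ∀ x ∈ Icc c d, |N' x| ≤ b x * N x) {x : ℝ} (hx : x ∈ Icc c d) :
    N c * Real.exp (-∫ y in c..x, b y) ≤ N x ∧ N x ≤ N c * Real.exp (∫ y in c..x, b y) := by
  have hcd : c ≤ d := hx.1.trans hx.2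
  set e : ℝ → ℝ := IccExtend hcd ((Icc c d).domRestrict b) with he
  have hec : Continuous e := (continuousOn_iff_continuous_domRestrict.1 hb).Icc_extend'
  have heb : ∀ y ∈ Icc c d, e y = b y := fun y hy => by
    rw [he, IccExtend_of_mem hcd _ hy]; rfl
  have hint : ∫ y in c..x, b y = ∫ y in c..x, e y := by
    refine integral_congr fun y hy => ?_
    rw [uIcc_of_le hx.1] at hy
    exact (heb y ⟨hy.1, hy.2.trans hx.2⟩).symm
  set B : ℝ → ℝ := fun t => ∫ y in c..t, e y with hBdef
  have hB : ∀ t, HasDerivAt B (e t) t := fun t => (hec.integral_hasStrictDerivAt c t).hasDerivAt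
  have hBc : B c = 0 := integral_same
  have key : ∀ s : ℝ, ∀ t ∈ Icc c d, HasDerivWithinAt (fun t => N t * Real.exp (s * B t))
      ((N' t + s * (b t * N t)) * Real.exp (s * B t)) (Icc c d) t := fun s t ht => by
    refine ((hN t ht).mul ((hB t).const_mul s).exp.hasDerivWithinAt).congr_deriv ?_
    rw [heb t ht]; ring
  have hcont : ∀ s : ℝ, ContinuousOn (fun t => N t * Real.exp (s * B t)) (Icc c d) :=
    fun s t ht => (key s t ht).continuousWithinAt
  have hmono : MonotoneOn (fun t => N t * Real.exp (1 * B t)) (Icc c d) :=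
    monotoneOn_of_hasDerivWithinAt_nonneg (convex_Icc c d) (hcont 1)
      (fun t ht => (key 1 t (interior_subset ht)).mono interior_subset)
      fun t ht => mul_nonneg
        (by linarith [neg_le_of_abs_le (hle t (interior_subset ht))]) (Real.exp_pos _).le
  have hanti : AntitoneOn (fun t => N t * Real.exp (-1 * B t)) (Icc c d) :=
    antitoneOn_of_hasDerivWithinAt_nonpos (convex_Icc c d) (hcont (-1))
      (fun t ht => (key (-1) t (interior_subset ht)).mono interior_subset)
      fun t ht => mul_nonpos_of_nonpos_of_nonneg
        (by linarith [le_of_abs_le (hle t (interior_subset ht))]) (Real.exp_pos _).le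
  have h1 := hmono (left_mem_Icc.2 hcd) hx hx.1
  have h2 := hanti (left_mem_Icc.2 hcd) hx hx.1
  simp only [hBc, mul_zero, Real.exp_zero, mul_one, one_mul, neg_one_mul] at h1 h2
  rw [hint, Real.exp_neg, ← div_eq_mul_inv]
  rw [Real.exp_neg, ← div_eq_mul_inv] at h2
  exact ⟨(div_le_iff₀ (Real.exp_pos _)).2 h1, (div_le_iff₀ (Real.exp_pos _)).1 h2⟩

/-- A second derivative of a `C²` function on a nondegenerate interval is continuous. -/
theorem continuousOn_second_deriv_Icc {c d : ℝ} (hcd : c < d) {f g g' : ℝ → ℝ}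
    (hf : ContDiffOn ℝ 2 f (Icc c d))
    (hg : ∀ x ∈ Icc c d, HasDerivWithinAt f (g x) (Icc c d) x)
    (hg' : ∀ x ∈ Icc c d, HasDerivWithinAt g (g' x) (Icc c d) x) :
    ContinuousOn g' (Icc c d) := by
  have hu := uniqueDiffOn_Icc hcd
  have h1 : ContDiffOn ℝ 1 g (Icc c d) :=
    (hf.derivWithin hu (by norm_num)).congr fun x hx => ((hg x hx).derivWithin (hu x hx)).symm
  exact (h1.continuousOn_derivWithin hu le_rfl).congr
    fun x hx => ((hg' x hx).derivWithin (hu x hx)).symm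

/-- The energy identity: the skew part of the system drops out of the derivative of `‖U‖²`. -/
theorem hasDerivWithinAt_energy {U₁ U₂ : ℝ → ℂ} {s : Set ℝ} {x p q : ℝ}
    (h₁ : HasDerivWithinAt U₁ ((p : ℂ) * U₂ x) s x)
    (h₂ : HasDerivWithinAt U₂ (((-p + q : ℝ) : ℂ) * U₁ x) s x) :
    HasDerivWithinAt (fun y => ‖U₁ y‖ ^ 2 + ‖U₂ y‖ ^ 2)
      (2 * q * inner ℝ (U₁ x) (U₂ x)) s x := by
  refine (h₁.norm_sq.add h₂.norm_sq).congr_deriv ?_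
  simp only [← Complex.real_smul, inner_smul_right]
  rw [real_inner_comm (U₁ x) (U₂ x)]
  ring

/-- **Lemma 3.4** (a-priori estimate for the oscillatory first-order system): if `U`
solves `U' = [(1/ε)A₀ + εA₁]U` on `[x_d,1]`, with `A₀ = √a·[[0,1],[−1,0]]` and
`A₁ = [[0,0],[2β,0]]`, `β = −(1/(2a^{1/4}))(a^{−1/4})''`, then for all `x ∈ [x_d,1]`
`‖U(x_d)‖ e^{−ε∫_{x_d}^x |β|} ≤ ‖U(x)‖ ≤ ‖U(x_d)‖ e^{ε∫_{x_d}^x |β|}`. -/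
theorem oscillatory_system_apriori (x_d : ℝ) (hxd : x_d < 1)
    (a : ℝ → ℝ) (ha : ContDiffOn ℝ 2 a (Icc x_d 1))
    (τos Mos : ℝ) (hτ : 0 < τos)
    (hbound : ∀ x ∈ Icc x_d 1, τos ≤ a x ∧ a x ≤ Mos)
    -- β = −(1/(2 a^{1/4}))·(a^{−1/4})'' , expressed via the first and second
    -- derivatives g, g' of a^{−1/4} on [x_d,1]
    (g g' β : ℝ → ℝ)
    (hg : ∀ x ∈ Icc x_d 1,
      HasDerivWithinAt (fun y => (a y) ^ (-(1:ℝ)/4)) (g x) (Icc x_d 1) x)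
    (hg' : ∀ x ∈ Icc x_d 1, HasDerivWithinAt g (g' x) (Icc x_d 1) x)
    (hβ : ∀ x ∈ Icc x_d 1, β x = -g' x / (2 * (a x) ^ ((1:ℝ)/4)))
    (ε : ℝ) (hε : 0 < ε)
    -- U = (U₁,U₂) solves the first-order system
    (U₁ U₂ : ℝ → ℂ)
    (hU₁ : ∀ x ∈ Icc x_d 1,
      HasDerivWithinAt U₁ ((Real.sqrt (a x) / ε : ℝ) * U₂ x) (Icc x_d 1) x)
    (hU₂ : ∀ x ∈ Icc x_d 1,
      HasDerivWithinAt U₂ (((-Real.sqrt (a x) / ε + 2 * ε * β x : ℝ)) * U₁ x)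
        (Icc x_d 1) x) :
    ∀ x ∈ Icc x_d 1,
      Real.sqrt (‖U₁ x_d‖ ^ 2 + ‖U₂ x_d‖ ^ 2) *
          Real.exp (-(ε * ∫ y in x_d..x, |β y|)) ≤
        Real.sqrt (‖U₁ x‖ ^ 2 + ‖U₂ x‖ ^ 2) ∧
      Real.sqrt (‖U₁ x‖ ^ 2 + ‖U₂ x‖ ^ 2) ≤
        Real.sqrt (‖U₁ x_d‖ ^ 2 + ‖U₂ x_d‖ ^ 2) *
          Real.exp (ε * ∫ y in x_d..x, |β y|) := by
  intro x hx
  have hpos : ∀ y ∈ Icc x_d 1, 0 < a y := fun y hy => hτ.trans_le (hbound y hy).1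
  have hg'c : ContinuousOn g' (Icc x_d 1) :=
    continuousOn_second_deriv_Icc hxd
      (ha.rpow_const_of_ne fun y hy => (hpos y hy).ne') hg hg'
  have hβc : ContinuousOn β (Icc x_d 1) := by
    refine ContinuousOn.congr (hg'c.neg.div (continuousOn_const.mul
      (ha.continuousOn.rpow_const fun y hy => Or.inl (hpos y hy).ne')) fun y hy => ?_) hβ
    exact (mul_pos two_pos (Real.rpow_pos_of_pos (hpos y hy) _)).ne'
  have hN : ∀ y ∈ Icc x_d 1, HasDerivWithinAt (fun y => ‖U₁ y‖ ^ 2 + ‖U₂ y‖ ^ 2)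
      (2 * (2 * ε * β y) * inner ℝ (U₁ y) (U₂ y)) (Icc x_d 1) y := fun y hy =>
    hasDerivWithinAt_energy (hU₁ y hy) (by simpa only [neg_div] using hU₂ y hy)
  have hle : ∀ y ∈ Icc x_d 1, |2 * (2 * ε * β y) * inner ℝ (U₁ y) (U₂ y)| ≤
      2 * ε * |β y| * (‖U₁ y‖ ^ 2 + ‖U₂ y‖ ^ 2) := fun y _ => by
    have h := abs_real_inner_le_norm (U₁ y) (U₂ y)
    have h' : 2 * |inner ℝ (U₁ y) (U₂ y)| ≤ ‖U₁ y‖ ^ 2 + ‖U₂ y‖ ^ 2 := by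
      nlinarith [sq_nonneg (‖U₁ y‖ - ‖U₂ y‖)]
    calc |2 * (2 * ε * β y) * inner ℝ (U₁ y) (U₂ y)|
        = 2 * ε * |β y| * (2 * |inner ℝ (U₁ y) (U₂ y)|) := by
          rw [abs_mul, abs_mul, abs_mul, abs_mul, abs_of_pos hε, abs_two]; ring
      _ ≤ _ := by gcongr
  have hsqrt : ∀ t : ℝ, Real.sqrt (‖U₁ x_d‖ ^ 2 + ‖U₂ x_d‖ ^ 2) * Real.exp t =
      Real.sqrt ((‖U₁ x_d‖ ^ 2 + ‖U₂ x_d‖ ^ 2) * Real.exp (2 * t)) := fun t => by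
    rw [Real.sqrt_mul (by positivity), two_mul, Real.exp_add,
      Real.sqrt_mul_self (Real.exp_pos t).le]
  have h := gronwall_two_sided (b := fun y => 2 * ε * |β y|)
    (continuousOn_const.mul hβc.abs) hN hle hx
  rw [intervalIntegral.integral_const_mul, mul_assoc] at h
  rw [hsqrt, hsqrt, mul_neg]
  exact ⟨Real.sqrt_le_sqrt h.1, Real.sqrt_le_sqrt h.2⟩
end
end

section
/- Assume Hypothesis A on (0,x_d) (V ∈ W^{2,∞}(0,x_d), E > 0, 0 < τ_ev ≤ V − E ≤ M_ev) and Hypothesis B on [x_d,1] (V ∈ C⁵[x_d,1], 0 < τ_os ≤ a(x) := E − V(x) ≤ M_os, and 0 < ε ≤ ε₀ with ε₀ < min{1, min_{x∈[x_d,1]} a(x)^{1/4} β₊(x)^{−1/2}} where β₊ is the nonnegative part of β = −(1/(2a^{1/4}))(a^{−1/4})''). Let χ be the solution of the evanescent-region BVP ε²χ'' + aχ = 0 on (0,x_d), εχ'(0) − √|a(0)| χ(0) = 0, εχ'(x_d) = 1, and let U solve U' = [(1/ε)A₀ + εA₁]U on [x_d,1] with A₀ = √a·[[0,1],[−1,0]],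 A₁ = [[0,0],[2β,0]] and initial condition U(x_d) = A(x_d+)·(χ(x_d), 1)ᵀ, where A(x) = [[a(x)^{1/4}, 0],[(ε/4)a(x)^{−5/4}a'(x), a(x)^{−1/4}]] and a(x_d+), a'(x_d+) denote the right-sided limits. Then there exist constants C₃, C₄ > 0 independent of ε ∈ (0,ε₀] such that C₃ ≤ ‖U(x)‖ ≤ C₄ for all x ∈ [x_d,1]. -/
open MeasureTheory Set intervalIntegral

noncomputable section

/-- `χ` (with derivative `χ'`) is a real-valued `W^{2,∞}` solution of `ε²χ'' + aχ = 0`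
on `(s,t)`. -/
def IsSchroSolR (ε : ℝ) (a : ℝ → ℝ) (s t : ℝ) (χ χ' : ℝ → ℝ) : Prop :=
  (∀ x ∈ Icc s t, HasDerivWithinAt χ (χ' x) (Icc s t) x) ∧
  (∃ K, LipschitzOnWith K χ' (Icc s t)) ∧
  (∀ᵐ x ∂(volume.restrict (Ioo s t)),
    ∃ d : ℝ, HasDerivWithinAt χ' d (Icc s t) x ∧ ε ^ 2 * d + a x * χ x = 0)

/-- An absolutely continuous function whose derivative is a.e. nonnegative is monotone. -/
theorem AbsolutelyContinuousOnInterval.monotoneOn_of_ae_hasDerivWithinAt_nonneg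
    {f : ℝ → ℝ} {s t : ℝ} (hst : s ≤ t) (hf : AbsolutelyContinuousOnInterval f s t)
    (hd : ∀ᵐ x ∂(volume.restrict (Ioo s t)), ∃ d : ℝ, HasDerivWithinAt f d (Icc s t) x ∧ 0 ≤ d) :
    MonotoneOn f (Icc s t) := by
  intro x hx y hy hxy
  have hac : AbsolutelyContinuousOnInterval f x y := by
    refine hf.mono ?_
    rw [uIcc_of_le hxy, uIcc_of_le hst]
    exact Icc_subset_Icc hx.1 hy.2
  rw [← sub_nonneg, ← hac.integral_deriv_eq_sub]
  refine intervalIntegral.integral_nonneg_of_ae_restrict hxy ?_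
  rw [Measure.restrict_congr_set Ioo_ae_eq_Icc.symm]
  have hsub : Ioo x y ⊆ Ioo s t := Ioo_subset_Ioo hx.1 hy.2
  filter_upwards [ae_restrict_of_ae_restrict_of_subset hsub hd,
    ae_restrict_mem measurableSet_Ioo] with z ⟨d, hzd, hd0⟩ hz
  rw [(hzd.hasDerivAt (Icc_mem_nhds (hsub hz).1 (hsub hz).2)).deriv]
  exact hd0

/-- In a region where `a ≤ -τ < 0`, a solution of `ε²χ'' + aχ = 0` satisfying the outgoing
condition at the left end point is controlled by its derivative at the right end point. -/
theorem IsSchroSolR.mul_sq_le_of_evanescent {ε s t τ : ℝ} {a χ χ' : ℝ → ℝ} (hε : 0 < ε)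
    (hst : s < t) (hτ : 0 < τ) (ha : ∀ x ∈ Ioo s t, τ ≤ -a x) (ha0 : τ ≤ -a s)
    (hχ : IsSchroSolR ε a s t χ χ') (h0 : ε * χ' s - Real.sqrt (-a s) * χ s = 0) :
    τ * χ t ^ 2 ≤ (ε * χ' t) ^ 2 := by
  obtain ⟨hd, ⟨K, hK⟩, hode⟩ := hχ
  have hs : s ∈ Icc s t := ⟨le_rfl, hst.le⟩
  have ht : t ∈ Icc s t := ⟨hst.le, le_rfl⟩
  have hac' : AbsolutelyContinuousOnInterval χ' s t := by
    refine LipschitzOnWith.absolutelyContinuousOnInterval (K := K) ?_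
    rwa [uIcc_of_le hst.le]
  have hac : AbsolutelyContinuousOnInterval χ s t := by
    obtain ⟨C, hC⟩ := isCompact_Icc.exists_bound_of_continuousOn hK.continuousOn
    refine LipschitzOnWith.absolutelyContinuousOnInterval (K := C.toNNReal) ?_
    rw [uIcc_of_le hst.le]
    refine (convex_Icc s t).lipschitzOnWith_of_nnnorm_hasDerivWithin_le hd fun x hx => ?_
    rw [← NNReal.coe_le_coe, coe_nnnorm]
    exact (hC x hx).trans (Real.le_coe_toNNReal C)
  have hεχ : ε * χ' s = Real.sqrt (-a s) * χ s := by linarith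
  have hmono : MonotoneOn (fun x => χ x * χ' x) (Icc s t) := by
    refine (hac.fun_mul hac').monotoneOn_of_ae_hasDerivWithinAt_nonneg hst.le ?_
    filter_upwards [hode, ae_restrict_mem measurableSet_Ioo] with x ⟨d, hxd, he⟩ hx
    refine ⟨_, (hd x (Ioo_subset_Icc_self hx)).mul hxd, ?_⟩
    have h1 : ε ^ 2 * (χ' x * χ' x + χ x * d) = (ε * χ' x) ^ 2 + -a x * χ x ^ 2 := by
      linear_combination χ x * he
    refine nonneg_of_mul_nonneg_right (a := ε ^ 2) ?_ (by positivity)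
    rw [h1]
    have := ha x hx
    have : 0 ≤ -a x := by linarith
    positivity
  have hprod : ∀ x ∈ Icc s t, 0 ≤ χ x * χ' x := by
    intro x hx
    refine le_trans ?_ (hmono hs hx hx.1)
    refine nonneg_of_mul_nonneg_right (a := ε) ?_ hε
    have : ε * (χ s * χ' s) = Real.sqrt (-a s) * χ s ^ 2 := by linear_combination χ s * hεχ
    rw [this]
    positivity
  have hmono2 : MonotoneOn
      (fun x => ε ^ 2 * (χ' x * χ' x) - τ * (χ x * χ x)) (Icc s t) := by
    refine (((hac'.fun_mul hac').const_mul (ε ^ 2)).sub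
      ((hac.fun_mul hac).const_mul τ)).monotoneOn_of_ae_hasDerivWithinAt_nonneg hst.le ?_
    filter_upwards [hode, ae_restrict_mem measurableSet_Ioo] with x ⟨d, hxd, he⟩ hx
    have hx1 := hd x (Ioo_subset_Icc_self hx)
    refine ⟨_, ((hxd.mul hxd).const_mul (ε ^ 2)).sub ((hx1.mul hx1).const_mul τ), ?_⟩
    have h1 : ε ^ 2 * (d * χ' x + χ' x * d) - τ * (χ' x * χ x + χ x * χ' x)
        = 2 * (χ x * χ' x) * (-a x - τ) := by
      linear_combination 2 * χ' x * he
    rw [h1]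
    exact mul_nonneg (mul_nonneg zero_le_two (hprod x (Ioo_subset_Icc_self hx)))
      (sub_nonneg.2 (ha x hx))
  have hle := hmono2 hs ht hst.le
  have hsq : (ε * χ' s) ^ 2 = -a s * χ s ^ 2 := by
    rw [hεχ, mul_pow, Real.sq_sqrt (hτ.le.trans ha0)]
  have := mul_le_mul_of_nonneg_right ha0 (sq_nonneg (χ s))
  simp only at hle
  nlinarith

/-- Two-sided Grönwall estimate for a planar rotation perturbed by a nilpotent matrix. -/
theorem normSq_bounds_of_perturbed_rotation {s t K : ℝ} {p q : ℝ → ℝ} {U₁ U₂ : ℝ → ℂ}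
    (h₁ : ∀ x ∈ Icc s t, HasDerivWithinAt U₁ ((p x : ℝ) * U₂ x) (Icc s t) x)
    (h₂ : ∀ x ∈ Icc s t, HasDerivWithinAt U₂ (((-p x + q x : ℝ)) * U₁ x) (Icc s t) x)
    (hq : ∀ x ∈ Icc s t, |q x| ≤ K) {x : ℝ} (hx : x ∈ Icc s t) :
    (‖U₁ s‖ ^ 2 + ‖U₂ s‖ ^ 2) * Real.exp (-(K * (x - s))) ≤ ‖U₁ x‖ ^ 2 + ‖U₂ x‖ ^ 2 ∧
      ‖U₁ x‖ ^ 2 + ‖U₂ x‖ ^ 2 ≤ (‖U₁ s‖ ^ 2 + ‖U₂ s‖ ^ 2) * Real.exp (K * (x - s)) := by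
  have hs : s ∈ Icc s t := ⟨le_rfl, hx.1.trans hx.2⟩
  set D : ℝ → ℝ := fun y => 2 * q y * inner ℝ (U₂ y) (U₁ y) with hD
  have hN : ∀ y ∈ Icc s t,
      HasDerivWithinAt (fun y => ‖U₁ y‖ ^ 2 + ‖U₂ y‖ ^ 2) (D y) (Icc s t) y := by
    intro y hy
    refine ((h₁ y hy).norm_sq.add (h₂ y hy).norm_sq).congr_deriv ?_
    simp only [← Complex.real_smul, real_inner_smul_right, hD, real_inner_comm (U₁ y) (U₂ y)]
    ring
  have hDle : ∀ y ∈ Icc s t, |D y| ≤ K * (‖U₁ y‖ ^ 2 + ‖U₂ y‖ ^ 2) := by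
    intro y hy
    have hi := abs_real_inner_le_norm (U₂ y) (U₁ y)
    have hAM := two_mul_le_add_sq ‖U₂ y‖ ‖U₁ y‖
    calc |D y| = |q y| * (2 * |inner ℝ (U₂ y) (U₁ y)|) := by
          simp only [hD, abs_mul, abs_two]; ring
      _ ≤ K * (‖U₁ y‖ ^ 2 + ‖U₂ y‖ ^ 2) :=
          mul_le_mul (hq y hy) (by linarith) (by positivity) ((abs_nonneg _).trans (hq y hy))
  have hexp : ∀ c y, HasDerivWithinAt (fun y => Real.exp (c * (y - s)))
      (Real.exp (c * (y - s)) * c) (Icc s t) y := by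
    intro c y
    simpa using (((hasDerivAt_id y).sub_const s).const_mul c).exp.hasDerivWithinAt
  have hder : ∀ c, ∀ y ∈ Icc s t,
      HasDerivWithinAt (fun y => (‖U₁ y‖ ^ 2 + ‖U₂ y‖ ^ 2) * Real.exp (c * (y - s)))
        ((D y + c * (‖U₁ y‖ ^ 2 + ‖U₂ y‖ ^ 2)) * Real.exp (c * (y - s))) (Icc s t) y :=
    fun c y hy => ((hN y hy).mul (hexp c y)).congr_deriv (by ring)
  have hcont : ∀ c, ContinuousOn
      (fun y => (‖U₁ y‖ ^ 2 + ‖U₂ y‖ ^ 2) * Real.exp (c * (y - s))) (Icc s t) :=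
    fun c y hy => (hder c y hy).continuousWithinAt
  have hup : MonotoneOn
      (fun y => (‖U₁ y‖ ^ 2 + ‖U₂ y‖ ^ 2) * Real.exp (K * (y - s))) (Icc s t) :=
    monotoneOn_of_hasDerivWithinAt_nonneg (convex_Icc s t) (hcont K)
      (fun y hy => (hder K y (interior_subset hy)).mono interior_subset) fun y hy =>
        mul_nonneg (by linarith [(abs_le.1 (hDle y (interior_subset hy))).1]) (Real.exp_nonneg _)
  have hdown : AntitoneOn
      (fun y => (‖U₁ y‖ ^ 2 + ‖U₂ y‖ ^ 2) * Real.exp (-K * (y - s))) (Icc s t) :=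
    antitoneOn_of_hasDerivWithinAt_nonpos (convex_Icc s t) (hcont (-K))
      (fun y hy => (hder (-K) y (interior_subset hy)).mono interior_subset) fun y hy =>
        mul_nonpos_of_nonpos_of_nonneg
          (by linarith [(abs_le.1 (hDle y (interior_subset hy))).2]) (Real.exp_nonneg _)
  have h3 := hup hs hx hx.1
  have h4 := hdown hs hx hx.1
  simp only [sub_self, mul_zero, Real.exp_zero, mul_one, neg_mul] at h3 h4
  rw [Real.exp_neg] at h4 ⊢
  exact ⟨(mul_inv_le_iff₀ (Real.exp_pos _)).2 h3, (mul_inv_le_iff₀ (Real.exp_pos _)).1 h4⟩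

/-- A second derivative (in the one-sided sense at the end points) of a `C²` function on a
compact interval is continuous. -/
theorem ContDiffOn.continuousOn_of_hasDerivWithinAt_twice {f g g' : ℝ → ℝ} {s t : ℝ}
    (hst : s < t) (hf : ContDiffOn ℝ 2 f (Icc s t))
    (hg : ∀ x ∈ Icc s t, HasDerivWithinAt f (g x) (Icc s t) x)
    (hg' : ∀ x ∈ Icc s t, HasDerivWithinAt g (g' x) (Icc s t) x) :
    ContinuousOn g' (Icc s t) := by
  have hu := uniqueDiffOn_Icc hst
  have h1 : ContDiffOn ℝ 1 g (Icc s t) :=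
    (hf.derivWithin hu (by norm_num)).congr fun x hx => ((hg x hx).derivWithin (hu x hx)).symm
  exact (h1.continuousOn_derivWithin hu le_rfl).congr
    fun x hx => ((hg' x hx).derivWithin (hu x hx)).symm

/-- **Lemma 3.4 / estimate \eqref{Uex-bound}**: under Hypotheses A and B, the solution
`U` of the oscillatory first-order system with interface data
`U(x_d) = A(x_d+)·(χ(x_d),1)ᵀ` from the evanescent region satisfies
`C₃ ≤ ‖U(x)‖ ≤ C₄` on `[x_d,1]`, with constants independent of `ε ∈ (0,ε₀]`.
The potential is modelled by `Vl` on the evanescent region `(0,x_d)` and by `Vr` on the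
oscillatory region `[x_d,1]` (it has a jump at `x_d`), with `a = E − V`. -/
theorem hybrid_U_upper_lower_bounds (x_d : ℝ) (hxd0 : 0 < x_d) (hxd1 : x_d < 1)
    (E : ℝ) (hE : 0 < E)
    -- Hypothesis A on (0,x_d)
    (Vl Vl' : ℝ → ℝ) (τev Mev : ℝ)
    (hVl : ∀ x ∈ Icc 0 x_d, HasDerivWithinAt Vl (Vl' x) (Icc 0 x_d) x)
    (hVlLip : ∃ K, LipschitzOnWith K Vl' (Icc 0 x_d))
    (hτev : 0 < τev)
    (hevbound : ∀ x ∈ Ioo 0 x_d, τev ≤ Vl x - E ∧ Vl x - E ≤ Mev)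
    -- Hypothesis B on [x_d,1]
    (Vr Vr' : ℝ → ℝ) (τos Mos : ℝ)
    (hVr : ContDiffOn ℝ 5 Vr (Icc x_d 1))
    (hVr' : ∀ x ∈ Icc x_d 1, HasDerivWithinAt Vr (Vr' x) (Icc x_d 1) x)
    (hτos : 0 < τos)
    (hosbound : ∀ x ∈ Icc x_d 1, τos ≤ E - Vr x ∧ E - Vr x ≤ Mos)
    -- β = −(1/(2a^{1/4}))(a^{−1/4})'' for a = E − Vr
    (g g' β : ℝ → ℝ)
    (hg : ∀ x ∈ Icc x_d 1,
      HasDerivWithinAt (fun y => (E - Vr y) ^ (-(1:ℝ)/4)) (g x) (Icc x_d 1) x)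
    (hg' : ∀ x ∈ Icc x_d 1, HasDerivWithinAt g (g' x) (Icc x_d 1) x)
    (hβ : ∀ x ∈ Icc x_d 1, β x = -g' x / (2 * (E - Vr x) ^ ((1:ℝ)/4)))
    -- the admissible range (0,ε₀] of the semiclassical parameter:
    -- ε₀ < min{1, min_x a^{1/4} β₊^{−1/2}}
    (ε₀ : ℝ) (hε₀ : 0 < ε₀) (hε₀1 : ε₀ < 1)
    (hε₀β : ∀ x ∈ Icc x_d 1, ε₀ ^ 2 * max (β x) 0 < Real.sqrt (E - Vr x)) :
    ∃ C₃ C₄ : ℝ, 0 < C₃ ∧ 0 < C₄ ∧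
      ∀ ε : ℝ, 0 < ε → ε ≤ ε₀ →
      -- χ : the solution of the evanescent-region BVP
      ∀ χ χ' : ℝ → ℝ,
        IsSchroSolR ε (fun x => E - Vl x) 0 x_d χ χ' →
        ε * χ' 0 - Real.sqrt (Vl 0 - E) * χ 0 = 0 →
        ε * χ' x_d = 1 →
      -- U : the solution of the oscillatory first-order system with the matched
      -- initial condition U(x_d) = A(x_d+)·(χ(x_d),1)ᵀ
      ∀ U₁ U₂ : ℝ → ℂ,
        (∀ x ∈ Icc x_d 1,
          HasDerivWithinAt U₁ ((Real.sqrt (E - Vr x) / ε : ℝ) * U₂ x) (Icc x_d 1) x) →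
        (∀ x ∈ Icc x_d 1,
          HasDerivWithinAt U₂
            (((-Real.sqrt (E - Vr x) / ε + 2 * ε * β x : ℝ)) * U₁ x) (Icc x_d 1) x) →
        U₁ x_d = (((E - Vr x_d) ^ ((1:ℝ)/4) * χ x_d : ℝ) : ℂ) →
        U₂ x_d = ((ε / 4 * ((E - Vr x_d) ^ (-(5:ℝ)/4)) * (-Vr' x_d) * χ x_d +
          (E - Vr x_d) ^ (-(1:ℝ)/4) : ℝ) : ℂ) →
        ∀ x ∈ Icc x_d 1,
          C₃ ≤ Real.sqrt (‖U₁ x‖ ^ 2 + ‖U₂ x‖ ^ 2) ∧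
          Real.sqrt (‖U₁ x‖ ^ 2 + ‖U₂ x‖ ^ 2) ≤ C₄ := by
  have hxd : x_d ∈ Icc x_d 1 := ⟨le_rfl, hxd1.le⟩
  have hapos : ∀ x ∈ Icc x_d 1, 0 < E - Vr x := fun x hx => hτos.trans_le (hosbound x hx).1
  -- `β` is bounded
  obtain ⟨B, hB⟩ : ∃ B, ∀ x ∈ Icc x_d 1, |β x| ≤ B := by
    have ha : ContDiffOn ℝ 2 (fun y => E - Vr y) (Icc x_d 1) :=
      contDiffOn_const.sub (hVr.of_le (by norm_num))
    have hgc : ContinuousOn g' (Icc x_d 1) :=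
      (ha.rpow_const_of_ne fun x hx => (hapos x hx).ne').continuousOn_of_hasDerivWithinAt_twice
        hxd1 hg hg'
    have hβc : ContinuousOn β (Icc x_d 1) := by
      refine ContinuousOn.congr (hgc.neg.div (continuousOn_const.mul
        (ha.continuousOn.rpow_const fun x hx => Or.inl (hapos x hx).ne')) fun x hx => ?_) hβ
      exact mul_ne_zero two_ne_zero (Real.rpow_pos_of_pos (hapos x hx) _).ne'
    exact isCompact_Icc.exists_bound_of_continuousOn hβc
  have hB0 : 0 ≤ B := (abs_nonneg _).trans (hB x_d hxd)
  have hVl0 : τev ≤ Vl 0 - E := by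
    have hc : ContinuousOn (fun x => Vl x - E) (closure (Ioo 0 x_d)) := by
      rw [closure_Ioo hxd0.ne]
      exact fun x hx => (hVl x hx).continuousWithinAt.sub continuousWithinAt_const
    refine le_on_closure (fun x hx => (hevbound x hx).1) continuousOn_const hc ?_
    rw [closure_Ioo hxd0.ne]
    exact ⟨le_rfl, hxd0.le⟩
  set α := (E - Vr x_d) ^ ((1:ℝ)/4) with hα
  set γ := (E - Vr x_d) ^ (-(1:ℝ)/4) with hγ
  set δ := (E - Vr x_d) ^ (-(5:ℝ)/4) with hδ
  have hα0 : 0 < α := Real.rpow_pos_of_pos (hapos x_d hxd) _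
  have hγ0 : 0 < γ := Real.rpow_pos_of_pos (hapos x_d hxd) _
  set k := δ / 4 * Vr' x_d with hk
  refine ⟨Real.sqrt (γ ^ 2 / (1 + (k / α) ^ 2) * Real.exp (-(2 * B))),
    Real.sqrt ((α ^ 2 / τev + 2 * (k ^ 2 / τev + γ ^ 2)) * Real.exp (2 * B)),
    by positivity, by positivity, ?_⟩
  intro ε hε hεε₀ χ χ' hχ hχ0 hχ1 U₁ U₂ hU₁ hU₂ hi₁ hi₂ x hx
  have hε1 : ε ≤ 1 := hεε₀.trans hε₀1.le
  have hχle : χ x_d ^ 2 ≤ 1 / τev := by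
    have := hχ.mul_sq_le_of_evanescent hε hxd0 hτev
      (fun x hx => by rw [neg_sub]; exact (hevbound x hx).1) (by rwa [neg_sub])
      (by rwa [neg_sub])
    rw [hχ1, one_pow] at this
    rwa [le_div_iff₀' hτev]
  set c := χ x_d with hc
  have hn₁ : ‖U₁ x_d‖ ^ 2 = (α * c) ^ 2 := by
    rw [hi₁, Complex.norm_real, Real.norm_eq_abs, sq_abs]
  have hn₂ : ‖U₂ x_d‖ ^ 2 = (γ - ε * k * c) ^ 2 := by
    rw [hi₂, Complex.norm_real, Real.norm_eq_abs, sq_abs, hk]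
    ring
  have hεsq : ε ^ 2 ≤ 1 := pow_le_one₀ hε.le hε1
  have hlow : γ ^ 2 / (1 + (k / α) ^ 2) ≤ ‖U₁ x_d‖ ^ 2 + ‖U₂ x_d‖ ^ 2 := by
    rw [hn₁, hn₂, div_le_iff₀ (by positivity)]
    set r := ε * (k / α) with hr
    set u := α * c with hu
    have hru : ε * k * c = r * u := by
      rw [hr, hu]; field_simp
    have hrle : r ^ 2 ≤ (k / α) ^ 2 := by
      rw [hr, mul_pow]; exact mul_le_of_le_one_left (sq_nonneg _) hεsq
    rw [hru]
    calc γ ^ 2 ≤ (u ^ 2 + (γ - r * u) ^ 2) * (1 + r ^ 2) := by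
          nlinarith [sq_nonneg (u - r * (γ - r * u))]
      _ ≤ _ := by gcongr
  have hupp : ‖U₁ x_d‖ ^ 2 + ‖U₂ x_d‖ ^ 2 ≤ α ^ 2 / τev + 2 * (k ^ 2 / τev + γ ^ 2) := by
    have h1 : (α * c) ^ 2 ≤ α ^ 2 / τev := by
      rw [mul_pow, div_eq_mul_one_div]; gcongr
    have h2 : (ε * k * c) ^ 2 ≤ k ^ 2 / τev := by
      rw [mul_pow, mul_pow, div_eq_mul_one_div]
      gcongr
      exact mul_le_of_le_one_left (sq_nonneg _) hεsq
    rw [hn₁, hn₂]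
    nlinarith [sq_nonneg (γ + ε * k * c)]
  obtain ⟨h1, h2⟩ := normSq_bounds_of_perturbed_rotation (K := 2 * B)
    (p := fun x => Real.sqrt (E - Vr x) / ε) (q := fun x => 2 * ε * β x) hU₁
    (by simpa only [neg_div] using hU₂)
    (fun y hy => by
      rw [abs_mul, abs_of_pos (by positivity)]
      exact mul_le_mul (by linarith) (hB y hy) (abs_nonneg _) zero_le_two) hx
  have hBx : 2 * B * (x - x_d) ≤ 2 * B :=
    mul_le_of_le_one_right (by positivity) (by linarith [hx.2])
  constructor
  · refine Real.sqrt_le_sqrt (le_trans ?_ h1)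
    gcongr
  · refine Real.sqrt_le_sqrt (h2.trans ?_)
    gcongr
end
end

section
/- Assume Hypothesis A: V ∈ W^{2,∞}(0,x_d), E > 0, 0 < τ_ev ≤ V(x) − E ≤ M_ev on (0,x_d), and 0 < ε < 1. Let 0 = x₁ < x₂ < ⋯ < x_N = x_d be a grid with h_n = x_{n+1} − x_n and h = max_n h_n, and let ζ_n (1 ≤ n ≤ N) be the WKB hat functions: with σ_n(x) = (1/ε)∫_{x_n}^x √(V(y)−E) dy, γ_n = σ_n(x_{n+1}), q_n(x) = (V(x_n)−E)^{1/4}/(V(x)−E)^{1/4}, w_n(x) = −(sinh σ_{n+1}(x)/sinh γ_n)·q_n(x) and v_n(x) = (sinh σ_n(x)/sinh γ_n)·q_{n+1}(x), one sets ζ_n = v_{n−1} on [x_{n−1},x_n], ζ_n = w_n on [x_n,x_{n+1}], and ζ_n = 0 elsewhere. Let χ_ex be the exact solution of the evanescent BVP ε²χ'' + (E−V)χ = 0 on (0,x_d), εχ'(0) − √(V(0)−E) χ(0) = 0, εχ'(x_d) = 1, and let Π_h^ε χ_ex := Σ_{n=1}^N χ_ex(x_n) ζ_n be its interpolant. Then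 the interpolation error e¹_h := χ_ex − Π_h^ε χ_ex satisfies, with C > 0 independent of ε, h and the grid: ‖e¹_h‖_{L²(0,x_d)} ≤ C √ε · h · min{ε, h}, ε‖(e¹_h)'‖_{L²(0,x_d)} ≤ C ε^{3/2} h, ‖e¹_h‖_{C[0,x_d]} ≤ C √h · min{ε^{3/2}, h^{3/2}}, and ε‖(e¹_h)'‖_{L^∞(0,x_d)} ≤ C ε √h · min{√ε, √h}. -/
open MeasureTheory Set intervalIntegral

noncomputable section

/-- The WKB phase `σ_n(t) = (1/ε)∫_{x_n}^t √(V(y)−E) dy`. -/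
def sigf (V : ℝ → ℝ) (E ε : ℝ) (p : ℕ → ℝ) (n : ℕ) (t : ℝ) : ℝ :=
  (1 / ε) * ∫ y in (p n)..t, Real.sqrt (V y - E)

/-- `γ_n = σ_n(x_{n+1})`. -/
def gamf (V : ℝ → ℝ) (E ε : ℝ) (p : ℕ → ℝ) (n : ℕ) : ℝ :=
  sigf V E ε p n (p (n + 1))

/-- `q_n(t) = (V(x_n)−E)^{1/4}/(V(t)−E)^{1/4}`. -/
def qfun (V : ℝ → ℝ) (E : ℝ) (p : ℕ → ℝ) (n : ℕ) (t : ℝ) : ℝ :=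
  (V (p n) - E) ^ ((1:ℝ)/4) / (V t - E) ^ ((1:ℝ)/4)

/-- `w_n(t) = −(sinh σ_{n+1}(t)/sinh γ_n)·q_n(t)`. -/
def wfun (V : ℝ → ℝ) (E ε : ℝ) (p : ℕ → ℝ) (n : ℕ) (t : ℝ) : ℝ :=
  -(Real.sinh (sigf V E ε p (n + 1) t) / Real.sinh (gamf V E ε p n)) * qfun V E p n t

/-- `v_n(t) = (sinh σ_n(t)/sinh γ_n)·q_{n+1}(t)`. -/
def vfun (V : ℝ → ℝ) (E ε : ℝ) (p : ℕ → ℝ) (n : ℕ) (t : ℝ) : ℝ :=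
  (Real.sinh (sigf V E ε p n t) / Real.sinh (gamf V E ε p n)) * qfun V E p (n + 1) t

/-- The WKB hat function `ζ_n`: it equals `v_{n−1}` on `[x_{n−1},x_n]`, `w_n` on
`[x_n,x_{n+1}]` (one-sided at `n = 1` and `n = N`) and vanishes elsewhere. -/
def zetaHat (V : ℝ → ℝ) (E ε : ℝ) (p : ℕ → ℝ) (N n : ℕ) (t : ℝ) : ℝ :=
  if 2 ≤ n ∧ p (n - 1) ≤ t ∧ t ≤ p n then vfun V E ε p (n - 1) t
  else if n < N ∧ p n ≤ t ∧ t ≤ p (n + 1) then wfun V E ε p n t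
  else 0

open Filter Topology

/-- A continuous function, nonpositive at both ends of an interval, whose derivative is
increasing to the right of each point where the function is positive, is nonpositive. -/
lemma nonpos_of_deriv_increasing_of_pos {s t : ℝ} {f F : ℝ → ℝ}
    (hf : ContinuousOn f (Icc s t)) (hs : f s ≤ 0) (ht : f t ≤ 0)
    (hF : ∀ x ∈ Ioo s t, HasDerivAt f (F x) x)
    (hinc : ∀ x ∈ Ioo s t, 0 < f x → ∀ᶠ y in 𝓝[>] x, F x < F y) :
    ∀ x ∈ Icc s t, f x ≤ 0 := by
  intro x hx
  by_contra! hpos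
  obtain ⟨z, hz, hmax⟩ := isCompact_Icc.exists_isMaxOn ⟨x, hx⟩ hf
  have hzpos : 0 < f z := hpos.trans_le (hmax hx)
  have hzI : z ∈ Ioo s t := by
    refine ⟨lt_of_le_of_ne hz.1 ?_, lt_of_le_of_ne hz.2 ?_⟩
    · rintro rfl; exact absurd hs (not_le.mpr hzpos)
    · rintro rfl; exact absurd ht (not_le.mpr hzpos)
  have hz0 : F z = 0 :=
    (hmax.isLocalMax (Icc_mem_nhds hzI.1 hzI.2)).hasDerivAt_eq_zero (hF z hzI)
  have hev := hinc z hzI hzpos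
  rw [hz0] at hev
  obtain ⟨u, hu, hsub⟩ := (mem_nhdsGT_iff_exists_Ioo_subset' hzI.2).mp hev
  set v := min u t with hv
  have hzv : z < v := lt_min hu hzI.2
  have hmono : StrictMonoOn f (Icc z v) := by
    apply strictMonoOn_of_deriv_pos (convex_Icc z v)
      (hf.mono (Icc_subset_Icc hz.1 (min_le_right _ _)))
    intro y hy
    rw [interior_Icc] at hy
    have hyI : y ∈ Ioo s t := ⟨hzI.1.trans hy.1, hy.2.trans_le (min_le_right _ _)⟩
    rw [(hF y hyI).deriv]
    exact hsub ⟨hy.1, hy.2.trans_le (min_le_left _ _)⟩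
  have h1 := hmono (left_mem_Icc.mpr hzv.le) (right_mem_Icc.mpr hzv.le) hzv
  have h2 : f v ≤ f z := hmax ⟨hz.1.trans hzv.le, min_le_right _ _⟩
  linarith

/-- One-sided form of the residual inequality `|e'' - (c / ε²) e| ≤ K`: the first derivative `D`
of `e` has right difference quotients within `K` of `c e / ε²`. -/
def HasRightResidual (ε : ℝ) (c e D : ℝ → ℝ) (K x : ℝ) : Prop :=
  ∀ r, K < r → ∀ᶠ y in 𝓝[>] x, |D y - D x - c x * e x / ε ^ 2 * (y - x)| ≤ r * (y - x)

lemma HasRightResidual.neg {ε : ℝ} {c e D : ℝ → ℝ} {K x : ℝ} (h : HasRightResidual ε c e D K x) :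
    HasRightResidual ε c (fun y => -e y) (fun y => -D y) K x := by
  intro r hr
  filter_upwards [h r hr] with y hy
  rw [← abs_neg]
  convert hy using 2
  ring

/-- One-sided maximum principle for `e'' - (c / ε²) e` with homogeneous Dirichlet conditions. -/
lemma le_of_hasRightResidual {s t ε τ K : ℝ} {c e D : ℝ → ℝ} (hε : 0 < ε) (hτ : 0 < τ)
    (hK : 0 ≤ K) (he : ContinuousOn e (Icc s t)) (hs : e s = 0) (ht : e t = 0)
    (hD : ∀ x ∈ Ioo s t, HasDerivAt e (D x) x) (hc : ∀ x ∈ Ioo s t, τ ≤ c x)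
    (hres : ∀ x ∈ Ioo s t, HasRightResidual ε c e D K x) :
    ∀ x ∈ Icc s t, e x ≤ K * (1 + 1 / τ) * min ε (t - s) ^ 2 := by
  intro x hx
  have hst : s ≤ t := hx.1.trans hx.2
  have h1 : e x ≤ K * (1 / τ) * ε ^ 2 := by
    have := nonpos_of_deriv_increasing_of_pos (f := fun y => e y - K * (1 / τ) * ε ^ 2) (F := D)
      (he.sub continuousOn_const) (by rw [hs]; simp only [zero_sub, Left.neg_nonpos_iff]; positivity)
      (by rw [ht]; simp only [zero_sub, Left.neg_nonpos_iff]; positivity)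
      (fun y hy => (hD y hy).sub_const _) ?_ x hx
    · linarith
    intro y hy hpos
    have hgap : K < c y * e y / ε ^ 2 := by
      rw [lt_div_iff₀ (by positivity)]
      have h0 : K * (1 / τ) * ε ^ 2 < e y := by linarith
      have h0' : 0 < e y := lt_of_le_of_lt (by positivity) h0
      calc K * ε ^ 2 = τ * (K * (1 / τ) * ε ^ 2) := by field_simp
        _ < τ * e y := by gcongr
        _ ≤ c y * e y := by gcongr; exact hc y hy
    filter_upwards [hres y hy _ (left_lt_add_div_two.mpr hgap), self_mem_nhdsWithin] with z hz hzy
    have hzy' : 0 < z - y := sub_pos.mpr hzy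
    have := (abs_le.mp hz).1
    nlinarith
  have h2 : e x ≤ K * (t - s) ^ 2 := by
    have := nonpos_of_deriv_increasing_of_pos (f := fun y => e y - K * ((y - s) * (t - y)))
      (F := fun y => D y - K * (s + t - 2 * y))
      (he.sub (by fun_prop)) (by simp [hs]) (by simp [ht]) ?_ ?_ x hx
    · have : (x - s) * (t - x) ≤ (t - s) ^ 2 := by nlinarith [hx.1, hx.2]
      have := mul_le_mul_of_nonneg_left this hK
      linarith
    · intro y hy
      have h3 : HasDerivAt (fun y => K * ((y - s) * (t - y))) (K * (s + t - 2 * y)) y := by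
        convert! (((hasDerivAt_id y).sub_const s).mul ((hasDerivAt_id y).const_sub t)).const_mul K
          using 1
        simp only [id]; ring
      exact (hD y hy).sub h3
    · intro y hy hpos
      have hey : 0 < e y := by
        have : 0 ≤ K * ((y - s) * (t - y)) :=
          mul_nonneg hK (mul_nonneg (sub_nonneg.mpr hy.1.le) (sub_nonneg.mpr hy.2.le))
        linarith
      have hgap : 0 < c y * e y / ε ^ 2 := by
        have := hτ.trans_le (hc y hy)
        positivity
      filter_upwards [hres y hy _ (lt_add_of_pos_right K (half_pos hgap)), self_mem_nhdsWithin]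
        with z hz hzy
      have hzy' : 0 < z - y := sub_pos.mpr hzy
      have := (abs_le.mp hz).1
      nlinarith [mul_nonneg hK hzy'.le, mul_pos hgap hzy']
  have hτ' : 0 ≤ 1 / τ := by positivity
  rcases min_cases ε (t - s) with ⟨hm, -⟩ | ⟨hm, -⟩ <;> rw [hm]
  · nlinarith [mul_nonneg hK (sq_nonneg ε)]
  · nlinarith [mul_nonneg (mul_nonneg hK hτ') (sq_nonneg (t - s))]

/-- Maximum principle for `e'' - (c / ε²) e` with homogeneous Dirichlet conditions. -/
lemma abs_le_of_hasRightResidual {s t ε τ K : ℝ} {c e D : ℝ → ℝ} (hε : 0 < ε) (hτ : 0 < τ)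
    (hK : 0 ≤ K) (he : ContinuousOn e (Icc s t)) (hs : e s = 0) (ht : e t = 0)
    (hD : ∀ x ∈ Ioo s t, HasDerivAt e (D x) x) (hc : ∀ x ∈ Ioo s t, τ ≤ c x)
    (hres : ∀ x ∈ Ioo s t, HasRightResidual ε c e D K x) :
    ∀ x ∈ Icc s t, |e x| ≤ K * (1 + 1 / τ) * min ε (t - s) ^ 2 := by
  intro x hx
  refine abs_le'.mpr ⟨le_of_hasRightResidual hε hτ hK he hs ht hD hc hres x hx, ?_⟩
  exact le_of_hasRightResidual (e := fun y => -e y) (D := fun y => -D y) hε hτ hK he.neg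
    (by simp [hs]) (by simp [ht]) (fun y hy => (hD y hy).neg) hc (fun y hy => (hres y hy).neg) x hx

/-- A continuous function whose right difference quotients are bounded by `L` is `L`-Lipschitz. -/
lemma abs_sub_le_of_eventually_right {s t L : ℝ} {D : ℝ → ℝ} (hD : ContinuousOn D (Ioo s t))
    (hL : ∀ x ∈ Ioo s t, ∀ r, L < r → ∀ᶠ y in 𝓝[>] x, |D y - D x| ≤ r * (y - x)) :
    ∀ x ∈ Ioo s t, ∀ y ∈ Ioo s t, x ≤ y → |D y - D x| ≤ L * (y - x) := by
  intro x hx y hy hxy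
  refine le_of_forall_gt_imp_ge_of_dense fun b hb => ?_
  rcases hxy.eq_or_lt with rfl | hxy
  · simp at hb ⊢; exact hb.le
  obtain ⟨r, hLr, hrb⟩ : ∃ r, L < r ∧ r * (y - x) ≤ b :=
    ⟨b / (y - x), (lt_div_iff₀ (sub_pos.mpr hxy)).mpr hb,
      (div_mul_cancel₀ b (sub_pos.mpr hxy).ne').le⟩
  have hsub : Icc x y ⊆ Ioo s t := fun z hz => ⟨hx.1.trans_le hz.1, hz.2.trans_lt hy.2⟩
  refine le_trans ?_ hrb
  have key := image_norm_le_of_liminf_right_slope_norm_lt_deriv_boundary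
    (f := fun z => D z - D x) (f' := fun _ => L) (a := x) (b := y)
    (B := fun z => r * (z - x)) (B' := fun _ => r)
    ((hD.mono hsub).sub continuousOn_const) ?_ (by simp) (by fun_prop) ?_ (fun _ _ _ => hLr)
    (right_mem_Icc.mpr hxy.le)
  · simpa using key
  · intro z hz q hq
    apply Eventually.frequently
    obtain ⟨q', hq1, hq2⟩ := exists_between hq
    filter_upwards [hL z (hsub (Ico_subset_Icc_self hz)) q' hq1, self_mem_nhdsWithin] with w hw hzw
    have hzw' : 0 < w - z := sub_pos.mpr hzw
    rw [slope_def_field, div_lt_iff₀ hzw']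
    simp only [Function.comp_apply, Real.norm_eq_abs]
    have h1 := abs_sub_abs_le_abs_sub (D w - D x) (D z - D x)
    rw [sub_sub_sub_cancel_right] at h1
    nlinarith
  · intro z _
    simpa using (((hasDerivAt_id z).sub_const x).const_mul r).hasDerivWithinAt

/-- Derivative bound accompanying `abs_le_of_hasRightResidual`. -/
lemma abs_deriv_le_of_hasRightResidual {s t ε τ M K : ℝ} {c e D : ℝ → ℝ} (hε : 0 < ε) (hτ : 0 < τ)
    (hK : 0 ≤ K) (he : ContinuousOn e (Icc s t)) (hs : e s = 0) (ht : e t = 0)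
    (hD : ∀ x ∈ Ioo s t, HasDerivAt e (D x) x) (hDc : ContinuousOn D (Ioo s t))
    (hc : ∀ x ∈ Ioo s t, τ ≤ c x) (hcM : ∀ x ∈ Ioo s t, c x ≤ M)
    (hres : ∀ x ∈ Ioo s t, HasRightResidual ε c e D K x) :
    ∀ x ∈ Ioo s t, |D x| ≤ K * ((M + 2) * (1 + 1 / τ) + 1) * min ε (t - s) := by
  intro x hx
  have hst : s < t := hx.1.trans hx.2
  set m := min ε (t - s) with hm
  have hm0 : 0 < m := lt_min hε (sub_pos.mpr hst)
  set A := K * (1 + 1 / τ) with hA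
  have hA0 : 0 ≤ A := by positivity
  have hbd : ∀ x ∈ Icc s t, |e x| ≤ A * m ^ 2 :=
    abs_le_of_hasRightResidual hε hτ hK he hs ht hD hc hres
  have hM0 : 0 ≤ M := hτ.le.trans ((hc x hx).trans (hcM x hx))
  have hLip := abs_sub_le_of_eventually_right (L := M * A + K) hDc (by
    intro y hy r hr
    have hterm : |c y * e y / ε ^ 2| ≤ M * A := by
      rw [abs_div, abs_mul, abs_of_pos (hτ.trans_le (hc y hy)), abs_of_pos (pow_pos hε 2),
        div_le_iff₀ (by positivity)]
      calc c y * |e y| ≤ M * (A * m ^ 2) :=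
            mul_le_mul (hcM y hy) (hbd y (Ioo_subset_Icc_self hy)) (abs_nonneg _) hM0
        _ ≤ M * (A * ε ^ 2) := by gcongr; exact min_le_left _ _
        _ = M * A * ε ^ 2 := by ring
    filter_upwards [hres y hy (r - M * A) (by linarith), self_mem_nhdsWithin] with z hz hzy
    have hzy' : 0 < z - y := sub_pos.mpr hzy
    calc |D z - D y|
        = |(D z - D y - c y * e y / ε ^ 2 * (z - y)) + c y * e y / ε ^ 2 * (z - y)| := by
          congr 1; ring
      _ ≤ (r - M * A) * (z - y) + M * A * (z - y) := by
          refine (abs_add_le _ _).trans (add_le_add hz ?_)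
          rw [abs_mul, abs_of_pos hzy']
          gcongr
      _ = r * (z - y) := by ring)
  obtain ⟨a, hsa, hax, hxa, hat⟩ : ∃ a, s ≤ a ∧ a ≤ x ∧ x ≤ a + m ∧ a + m ≤ t := by
    have hmt : m ≤ t - s := min_le_right _ _
    rcases le_total (x - s) m with h | h
    · exact ⟨s, le_rfl, hx.1.le, by linarith, by linarith⟩
    · exact ⟨x - m, by linarith, by linarith, by linarith, by linarith [hx.2]⟩
  have hsubc : Icc a (a + m) ⊆ Icc s t := Icc_subset_Icc hsa hat
  have hsubo : Ioo a (a + m) ⊆ Ioo s t := Ioo_subset_Ioo hsa hat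
  obtain ⟨ξ, hξ, hξe⟩ := exists_hasDerivAt_eq_slope e D (by linarith) (he.mono hsubc)
    (fun y hy => hD y (hsubo hy))
  have hξbd : |D ξ| ≤ 2 * A * m := by
    rw [hξe, add_sub_cancel_left, abs_div, abs_of_pos hm0, div_le_iff₀ hm0]
    have h1 := hbd (a + m) (hsubc (right_mem_Icc.mpr (by linarith)))
    have h2 := hbd a (hsubc (left_mem_Icc.mpr (by linarith)))
    have := abs_sub (e (a + m)) (e a)
    nlinarith
  have hdiff : |D x - D ξ| ≤ (M * A + K) * m := by
    have hL0 : 0 ≤ M * A + K := by positivity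
    rcases le_total x ξ with h | h
    · rw [abs_sub_comm]
      refine (hLip x hx ξ (hsubo hξ) h).trans ?_
      gcongr
      linarith [hξ.2]
    · refine (hLip ξ (hsubo hξ) x hx h).trans ?_
      gcongr
      linarith [hξ.1]
  have h3 : |D x| ≤ |D x - D ξ| + |D ξ| := by
    simpa using abs_add_le (D x - D ξ) (D ξ)
  calc |D x| ≤ (M * A + K) * m + 2 * A * m := by linarith
    _ = K * ((M + 2) * (1 + 1 / τ) + 1) * m := by rw [hA]; ring

/-- The derivative of a `W^{2,∞}` solution is continuously differentiable when the coefficient is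
continuous. -/
lemma IsSchroSolR.hasDerivAt_deriv {ε s t : ℝ} {a χ χ' : ℝ → ℝ} (h : IsSchroSolR ε a s t χ χ')
    (hε : 0 < ε) (ha : ContinuousOn a (Icc s t)) :
    ∀ x ∈ Ioo s t, HasDerivAt χ' (-a x * χ x / ε ^ 2) x := by
  obtain ⟨h1, ⟨K, h2⟩, h3⟩ := h
  have hχ : ContinuousOn χ (Icc s t) := fun x hx => (h1 x hx).continuousWithinAt
  have hF : ContinuousOn (fun x => -a x * χ x / ε ^ 2) (Icc s t) := (ha.neg.mul hχ).div_const _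
  rw [ae_restrict_iff' measurableSet_Ioo] at h3
  have key : ∀ x ∈ Icc s t, χ' x = χ' s + ∫ y in s..x, -a y * χ y / ε ^ 2 := by
    intro x hx
    have hsub : uIcc s x ⊆ Icc s t := by rw [uIcc_of_le hx.1]; exact Icc_subset_Icc_right hx.2
    have h4 := (h2.mono hsub).absolutelyContinuousOnInterval.integral_deriv_eq_sub
    rw [← sub_eq_iff_eq_add', ← h4]
    apply intervalIntegral.integral_congr_ae
    have hne : ∀ᵐ y : ℝ, y ≠ x := by simp [ae_iff]
    filter_upwards [h3, hne] with y hy hyx hyI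
    rw [uIoc_of_le hx.1] at hyI
    have hyI' : y ∈ Ioo s t := ⟨hyI.1, (lt_of_le_of_ne hyI.2 hyx).trans_le hx.2⟩
    obtain ⟨d, hd, hd'⟩ := hy hyI'
    rw [(hd.hasDerivAt (Icc_mem_nhds hyI'.1 hyI'.2)).deriv]
    field_simp
    linarith
  intro x hx
  have hnhds : Icc s t ∈ 𝓝 x := Icc_mem_nhds hx.1 hx.2
  have h5 : HasDerivAt (fun u => χ' s + ∫ y in s..u, -a y * χ y / ε ^ 2)
      (-a x * χ x / ε ^ 2) x := by
    refine (integral_hasDerivAt_right ?_ ?_ (hF.continuousAt hnhds)).const_add _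
    · apply ContinuousOn.intervalIntegrable
      rw [uIcc_of_le hx.1.le]
      exact hF.mono (Icc_subset_Icc_right hx.2.le)
    · exact ContinuousOn.stronglyMeasurableAtFilter isOpen_Ioo (hF.mono Ioo_subset_Icc_self) x hx
  refine h5.congr_of_eventuallyEq ?_
  filter_upwards [hnhds] with y hy using key y hy

/-- Energy estimates for solutions of `ε² χ'' = c χ` with the boundary conditions of the
evanescent problem. -/
lemma evanescent_energy {ε τ s t : ℝ} {c χ χ' : ℝ → ℝ} (hε : 0 < ε) (hτ : 0 < τ) (hst : s < t)
    (hχ : ContinuousOn χ (Icc s t)) (hχ' : ContinuousOn χ' (Icc s t))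
    (hd : ∀ x ∈ Ioo s t, HasDerivAt χ (χ' x) x)
    (hd' : ∀ x ∈ Ioo s t, HasDerivAt χ' (c x * χ x / ε ^ 2) x)
    (hc : ∀ x ∈ Icc s t, τ ≤ c x)
    (hbs : ε * χ' s - Real.sqrt (c s) * χ s = 0) (hbt : ε * χ' t = 1) :
    MonotoneOn (fun x => χ x ^ 2) (Icc s t) ∧ τ * χ t ^ 2 ≤ 1 ∧ 0 ≤ χ s * χ' s ∧
    ∀ x ∈ Icc s t, ∀ y ∈ Icc s t, x ≤ y →
      τ * (y - x) * χ x ^ 2 ≤ ε ^ 2 * (χ y * χ' y) - ε ^ 2 * (χ x * χ' x) := by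
  have hsI : s ∈ Icc s t := left_mem_Icc.mpr hst.le
  have htI : t ∈ Icc s t := right_mem_Icc.mpr hst.le
  have hcs : 0 < c s := hτ.trans_le (hc s hsI)
  have hbs' : χ' s = Real.sqrt (c s) * χ s / ε := by field_simp; linarith
  have hprod : ∀ x ∈ Ioo s t, HasDerivAt (fun x => χ x * χ' x)
      (χ' x ^ 2 + c x * χ x ^ 2 / ε ^ 2) x := by
    intro x hx
    convert! (hd x hx).mul (hd' x hx) using 1
    ring
  have hpm : MonotoneOn (fun x => χ x * χ' x) (Icc s t) := by
    refine monotoneOn_of_deriv_nonneg (convex_Icc s t) (hχ.mul hχ') ?_ ?_ <;> rw [interior_Icc]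
    · exact fun x hx => (hprod x hx).differentiableAt.differentiableWithinAt
    · intro x hx
      rw [(hprod x hx).deriv]
      have := hτ.trans_le (hc x (Ioo_subset_Icc_self hx))
      positivity
  have hps : 0 ≤ χ s * χ' s := by
    rw [hbs']
    have : χ s * (Real.sqrt (c s) * χ s / ε) = Real.sqrt (c s) * χ s ^ 2 / ε := by ring
    rw [this]; positivity
  have hpn : ∀ x ∈ Icc s t, 0 ≤ χ x * χ' x := fun x hx => hps.trans (hpm hsI hx hx.1)
  have hsqm : MonotoneOn (fun x => χ x ^ 2) (Icc s t) := by
    refine monotoneOn_of_deriv_nonneg (convex_Icc s t) (hχ.pow 2) ?_ ?_ <;> rw [interior_Icc]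
    · exact fun x hx => ((hd x hx).pow 2).differentiableAt.differentiableWithinAt
    · intro x hx
      have h1 : HasDerivAt (fun x => χ x ^ 2) (2 * (χ x * χ' x)) x := by
        convert! (hd x hx).pow 2 using 1
        simp; ring
      rw [h1.deriv]
      have := hpn x (Ioo_subset_Icc_self hx)
      positivity
  refine ⟨hsqm, ?_, hps, ?_⟩
  · have hG : MonotoneOn (fun x => ε ^ 2 * χ' x ^ 2 - τ * χ x ^ 2) (Icc s t) := by
      have h1 : ∀ x ∈ Ioo s t, HasDerivAt (fun x => ε ^ 2 * χ' x ^ 2 - τ * χ x ^ 2)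
          (2 * (c x - τ) * (χ x * χ' x)) x := by
        intro x hx
        convert! (((hd' x hx).pow 2).const_mul (ε ^ 2)).sub (((hd x hx).pow 2).const_mul τ) using 1
        field_simp; ring
      refine monotoneOn_of_deriv_nonneg (convex_Icc s t) (by fun_prop) ?_ ?_ <;> rw [interior_Icc]
      · exact fun x hx => (h1 x hx).differentiableAt.differentiableWithinAt
      · intro x hx
        rw [(h1 x hx).deriv]
        have h2 := hpn x (Ioo_subset_Icc_self hx)
        have h3 := sub_nonneg.mpr (hc x (Ioo_subset_Icc_self hx))
        positivity
    have h2 := hG hsI htI hst.le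
    simp only at h2
    have h3 : ε ^ 2 * χ' s ^ 2 = c s * χ s ^ 2 := by
      have h4 : ε * χ' s = Real.sqrt (c s) * χ s := by linarith
      rw [← mul_pow, h4, mul_pow, Real.sq_sqrt hcs.le]
    have h5 : ε ^ 2 * χ' t ^ 2 = 1 := by rw [← mul_pow, hbt, one_pow]
    have h6 : 0 ≤ (c s - τ) * χ s ^ 2 :=
      mul_nonneg (sub_nonneg.mpr (hc s hsI)) (sq_nonneg _)
    linarith
  · intro x hx y hy hxy
    have hsub : Icc x y ⊆ Icc s t := Icc_subset_Icc hx.1 hy.2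
    have h1 := (convex_Icc x y).mul_sub_le_image_sub_of_le_deriv
      (f := fun x => ε ^ 2 * (χ x * χ' x)) (C := τ * χ x ^ 2)
      (((hχ.mul hχ').mono hsub).const_mul _) ?_ ?_ x (left_mem_Icc.mpr hxy) y
      (right_mem_Icc.mpr hxy) hxy
    · linarith
    · rw [interior_Icc]
      exact fun z hz => ((hprod z ⟨hx.1.trans_lt hz.1, hz.2.trans_le hy.2⟩).const_mul
        _).differentiableAt.differentiableWithinAt
    · rw [interior_Icc]
      intro z hz
      have hzI : z ∈ Ioo s t := ⟨hx.1.trans_lt hz.1, hz.2.trans_le hy.2⟩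
      rw [((hprod z hzI).const_mul _).deriv]
      have h2 : χ x ^ 2 ≤ χ z ^ 2 := hsqm hx (Ioo_subset_Icc_self hzI) hz.1.le
      have h3 := hc z (Ioo_subset_Icc_self hzI)
      calc τ * χ x ^ 2 ≤ c z * χ z ^ 2 := by gcongr; exact (hτ.trans_le h3).le
        _ ≤ ε ^ 2 * χ' z ^ 2 + c z * χ z ^ 2 := le_add_of_nonneg_left (by positivity)
        _ = ε ^ 2 * (χ' z ^ 2 + c z * χ z ^ 2 / ε ^ 2) := by field_simp

lemma hasRightResidual_of_hasDerivAt {ε K x : ℝ} {c e D Q : ℝ → ℝ}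
    (hQ : HasDerivAt Q (c x * e x / ε ^ 2) x)
    (hDQ : ∀ᶠ y in 𝓝[>] x, |(D y - D x) - (Q y - Q x)| ≤ K * (y - x)) :
    HasRightResidual ε c e D K x := by
  intro r hr
  have h1 := (hasDerivAt_iff_isLittleO.mp hQ).def (sub_pos.mpr hr)
  filter_upwards [nhdsWithin_le_nhds h1, hDQ, self_mem_nhdsWithin] with y hy1 hy2 hy
  have hxy : 0 < y - x := sub_pos.mpr hy
  rw [Real.norm_eq_abs, Real.norm_eq_abs, abs_of_pos hxy, smul_eq_mul] at hy1
  calc |D y - D x - c x * e x / ε ^ 2 * (y - x)|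
      = |((D y - D x) - (Q y - Q x)) + (Q y - Q x - (y - x) * (c x * e x / ε ^ 2))| := by
        congr 1; ring
    _ ≤ K * (y - x) + (r - K) * (y - x) := (abs_add_le _ _).trans (add_le_add hy2 hy1)
    _ = r * (y - x) := by ring

/-- The derivative of `c ^ (-1/4)`, where `d` is the derivative of `c`. -/
def ampDeriv (c d : ℝ → ℝ) (x : ℝ) : ℝ := -(1 / 4) * (c x ^ (-(5:ℝ) / 4) * d x)

/-- The derivative of `c ^ (-1/4) * S` where `S' = (√c / ε) T`. -/
def wkbDeriv (ε : ℝ) (c c' S T : ℝ → ℝ) (x : ℝ) : ℝ :=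
  ampDeriv c c' x * S x + c x ^ ((1:ℝ) / 4) * T x / ε

lemma hasDerivAt_amp {c c' : ℝ → ℝ} {x : ℝ} (h : HasDerivAt c (c' x) x) (hc : 0 < c x) :
    HasDerivAt (fun y => c y ^ (-(1:ℝ) / 4)) (ampDeriv c c' x) x := by
  convert! h.rpow_const (p := -(1:ℝ) / 4) (Or.inl hc.ne') using 1
  rw [ampDeriv, show -(1:ℝ) / 4 - 1 = -(5:ℝ) / 4 by norm_num]
  ring

lemma hasDerivAt_wkb {ε x : ℝ} {c c' S T : ℝ → ℝ} (h : HasDerivAt c (c' x) x) (hc : 0 < c x)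
    (hS : HasDerivAt S (Real.sqrt (c x) / ε * T x) x) :
    HasDerivAt (fun y => c y ^ (-(1:ℝ) / 4) * S y) (wkbDeriv ε c c' S T x) x := by
  convert! (hasDerivAt_amp h hc).mul hS using 1
  rw [wkbDeriv, Real.sqrt_eq_rpow, show (1:ℝ) / 4 = -(1:ℝ) / 4 + 1 / 2 by norm_num,
    Real.rpow_add hc]
  ring

/-- First-order WKB functions solve the Schrödinger equation up to an `O(ε²)` residual. -/
lemma hasRightResidual_sub_wkb {ε s t A L x : ℝ} {c c' χ χ' S T : ℝ → ℝ}
    (hx : x ∈ Ioo s t) (hε : 0 < ε) (hc : 0 < c x) (hcd : HasDerivAt c (c' x) x)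
    (hL : ∀ y ∈ Ioo s t, |ampDeriv c c' y - ampDeriv c c' x| ≤ L * |y - x|)
    (hS : HasDerivAt S (Real.sqrt (c x) / ε * T x) x)
    (hT : HasDerivAt T (Real.sqrt (c x) / ε * S x) x)
    (hA : ∀ y ∈ Ioo s t, |S y| ≤ A) (hχ : HasDerivAt χ' (c x * χ x / ε ^ 2) x) :
    HasRightResidual ε c (fun y => χ y - c y ^ (-(1:ℝ) / 4) * S y)
      (fun y => χ' y - wkbDeriv ε c c' S T y) (L * A) x := by
  apply hasRightResidual_of_hasDerivAt
    (Q := fun y => χ' y - c y ^ ((1:ℝ) / 4) * T y / ε - ampDeriv c c' x * S y)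
  · have h1 := hcd.rpow_const (p := (1:ℝ) / 4) (Or.inl hc.ne')
    convert! (hχ.sub ((h1.mul hT).div_const ε)).sub (hS.const_mul (ampDeriv c c' x)) using 1
    set u := c x ^ ((1:ℝ) / 4) with hu
    have hu0 : 0 < u := Real.rpow_pos_of_pos hc _
    have e1 : Real.sqrt (c x) = u ^ 2 := by
      rw [Real.sqrt_eq_rpow, hu, ← Real.rpow_natCast, ← Real.rpow_mul hc.le]; norm_num
    have e2 : c x = u ^ 4 := by
      rw [hu, ← Real.rpow_natCast, ← Real.rpow_mul hc.le]; norm_num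
    have e3 : c x ^ (-(1:ℝ) / 4) = u⁻¹ := by
      rw [hu, ← Real.rpow_neg hc.le]; norm_num
    have e4 : c x ^ ((1:ℝ) / 4 - 1) = (u ^ 3)⁻¹ := by
      rw [hu, ← Real.rpow_natCast, ← Real.rpow_mul hc.le, ← Real.rpow_neg hc.le]; norm_num
    have e5 : c x ^ (-(5:ℝ) / 4) = (u ^ 5)⁻¹ := by
      rw [hu, ← Real.rpow_natCast, ← Real.rpow_mul hc.le, ← Real.rpow_neg hc.le]; norm_num
    rw [ampDeriv, e1, e3, e4, e5, e2]
    field_simp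
    ring
  · filter_upwards [Ioo_mem_nhdsGT hx.2, self_mem_nhdsWithin] with y hy hxy
    have hyI : y ∈ Ioo s t := ⟨hx.1.trans hy.1, hy.2⟩
    have hxy' : 0 < y - x := sub_pos.mpr hxy
    calc _ = |(ampDeriv c c' y - ampDeriv c c' x) * S y| := by
          rw [← abs_neg]; congr 1; simp only [wkbDeriv]; ring
      _ ≤ L * (y - x) * A := by
          rw [abs_mul]
          refine mul_le_mul ?_ (hA y hyI) (abs_nonneg _) ?_
          · simpa [abs_of_pos hxy'] using hL y hyI
          · simpa [abs_of_pos hxy'] using (abs_nonneg _).trans (hL y hyI)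
      _ = L * A * (y - x) := by ring

/-- `(α sinh((φ(t) - φ(x))/ε) + β sinh((φ(x) - φ(s))/ε)) / sinh((φ(t) - φ(s))/ε)`. -/
def sinhInterp (ε α β s t : ℝ) (φ : ℝ → ℝ) (x : ℝ) : ℝ :=
  (α * Real.sinh ((φ t - φ x) / ε) + β * Real.sinh ((φ x - φ s) / ε)) /
    Real.sinh ((φ t - φ s) / ε)

/-- The conjugate of `sinhInterp`. -/
def coshInterp (ε α β s t : ℝ) (φ : ℝ → ℝ) (x : ℝ) : ℝ :=
  (-α * Real.cosh ((φ t - φ x) / ε) + β * Real.cosh ((φ x - φ s) / ε)) /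
    Real.sinh ((φ t - φ s) / ε)

lemma hasDerivAt_sinhInterp {ε α β s t x k : ℝ} {φ : ℝ → ℝ} (h : HasDerivAt φ k x) :
    HasDerivAt (sinhInterp ε α β s t φ) (k / ε * coshInterp ε α β s t φ x) x := by
  convert! (((((h.const_sub (φ t)).div_const ε).sinh.const_mul α).add
    (((h.sub_const (φ s)).div_const ε).sinh.const_mul β)).div_const
      (Real.sinh ((φ t - φ s) / ε))) using 1
  simp only [coshInterp]; ring

lemma hasDerivAt_coshInterp {ε α β s t x k : ℝ} {φ : ℝ → ℝ} (h : HasDerivAt φ k x) :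
    HasDerivAt (coshInterp ε α β s t φ) (k / ε * sinhInterp ε α β s t φ x) x := by
  convert! (((((h.const_sub (φ t)).div_const ε).cosh.const_mul (-α)).add
    (((h.sub_const (φ s)).div_const ε).cosh.const_mul β)).div_const
      (Real.sinh ((φ t - φ s) / ε))) using 1
  simp only [sinhInterp]; ring

lemma abs_sinhInterp_le {ε α β s t x : ℝ} {φ : ℝ → ℝ} (hε : 0 < ε) (h1 : φ s ≤ φ x)
    (h2 : φ x ≤ φ t) (h3 : φ s < φ t) : |sinhInterp ε α β s t φ x| ≤ |α| + |β| := by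
  have hpos : 0 < Real.sinh ((φ t - φ s) / ε) := by
    rw [Real.sinh_pos_iff]; exact div_pos (sub_pos.mpr h3) hε
  rw [sinhInterp, abs_div, abs_of_pos hpos, div_le_iff₀ hpos, add_mul]
  refine (abs_add_le _ _).trans (add_le_add ?_ ?_) <;> rw [abs_mul, Real.abs_sinh] <;> gcongr <;>
    rw [Real.sinh_le_sinh, abs_of_nonneg (div_nonneg (by linarith) hε.le)] <;> gcongr

/-- Error of the local WKB interpolant on a single cell. -/
lemma wkb_cell_estimate {ε s t τ M L X : ℝ} {c c' φ χ χ' : ℝ → ℝ} (hε : 0 < ε) (hst : s < t)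
    (hτ : 0 < τ) (hL0 : 0 ≤ L) (hcc : ContinuousOn c (Icc s t))
    (hcd : ∀ x ∈ Ioo s t, HasDerivAt c (c' x) x)
    (hL : ∀ x ∈ Ioo s t, ∀ y ∈ Ioo s t, |ampDeriv c c' y - ampDeriv c c' x| ≤ L * |y - x|)
    (hcτ : ∀ x ∈ Icc s t, τ ≤ c x) (hcM : ∀ x ∈ Icc s t, c x ≤ M)
    (hφ : ContinuousOn φ (Icc s t)) (hφd : ∀ x ∈ Ioo s t, HasDerivAt φ (Real.sqrt (c x)) x)
    (hχ : ContinuousOn χ (Icc s t)) (hχd : ∀ x ∈ Ioo s t, HasDerivAt χ (χ' x) x)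
    (hχd' : ∀ x ∈ Ioo s t, HasDerivAt χ' (c x * χ x / ε ^ 2) x)
    (hXs : |χ s| ≤ X) (hXt : |χ t| ≤ X) :
    ∃ J : ℝ → ℝ, ContinuousOn J (Ioo s t) ∧
      (∀ x ∈ Ioo s t, HasDerivAt (fun y => c y ^ (-(1:ℝ) / 4) * sinhInterp ε
        (χ s * c s ^ ((1:ℝ) / 4)) (χ t * c t ^ ((1:ℝ) / 4)) s t φ y) (J x) x) ∧
      (∀ x ∈ Icc s t, |χ x - c x ^ (-(1:ℝ) / 4) * sinhInterp ε
        (χ s * c s ^ ((1:ℝ) / 4)) (χ t * c t ^ ((1:ℝ) / 4)) s t φ x| ≤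
        2 * L * M ^ ((1:ℝ) / 4) * ((M + 2) * (1 + 1 / τ) + 1) * X * min ε (t - s) ^ 2) ∧
      (∀ x ∈ Ioo s t, |χ' x - J x| ≤
        2 * L * M ^ ((1:ℝ) / 4) * ((M + 2) * (1 + 1 / τ) + 1) * X * min ε (t - s)) := by
  have hX : 0 ≤ X := (abs_nonneg _).trans hXs
  have hsI : s ∈ Icc s t := left_mem_Icc.mpr hst.le
  have htI : t ∈ Icc s t := right_mem_Icc.mpr hst.le
  have hpos : ∀ x ∈ Icc s t, 0 < c x := fun x hx => hτ.trans_le (hcτ x hx)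
  have hM : 0 < M := (hpos s hsI).trans_le (hcM s hsI)
  have hφm : StrictMonoOn φ (Icc s t) := by
    refine strictMonoOn_of_deriv_pos (convex_Icc s t) hφ fun x hx => ?_
    rw [interior_Icc] at hx
    rw [(hφd x hx).deriv]
    exact Real.sqrt_pos.mpr (hpos x (Ioo_subset_Icc_self hx))
  have hφst := hφm hsI htI hst
  set α := χ s * c s ^ ((1:ℝ) / 4) with hα
  set β := χ t * c t ^ ((1:ℝ) / 4) with hβ
  have hcoef : ∀ x ∈ Icc s t, |χ x| ≤ X → |χ x * c x ^ ((1:ℝ) / 4)| ≤ X * M ^ ((1:ℝ) / 4) := by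
    intro x hx hxX
    have h0 := (hpos x hx).le
    rw [abs_mul, abs_of_nonneg (Real.rpow_nonneg h0 _)]
    gcongr
    exact hcM x hx
  have hA : ∀ x ∈ Icc s t, |sinhInterp ε α β s t φ x| ≤ 2 * M ^ ((1:ℝ) / 4) * X := by
    intro x hx
    have h1 := abs_sinhInterp_le (α := α) (β := β) hε (hφm.monotoneOn hsI hx hx.1)
      (hφm.monotoneOn hx htI hx.2) hφst
    have h2 := hcoef s hsI hXs
    have h3 := hcoef t htI hXt
    linarith
  have hSd := fun x (hx : x ∈ Ioo s t) =>
    hasDerivAt_sinhInterp (ε := ε) (α := α) (β := β) (s := s) (t := t) (hφd x hx)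
  have hTd := fun x (hx : x ∈ Ioo s t) =>
    hasDerivAt_coshInterp (ε := ε) (α := α) (β := β) (s := s) (t := t) (hφd x hx)
  have hJd := fun x (hx : x ∈ Ioo s t) =>
    hasDerivAt_wkb (hcd x hx) (hpos x (Ioo_subset_Icc_self hx)) (hSd x hx)
  have hsinh : Real.sinh ((φ t - φ s) / ε) ≠ 0 := by
    rw [Real.sinh_ne_zero]; exact (div_pos (sub_pos.mpr hφst) hε).ne'
  have hinv : ∀ x ∈ Icc s t, c x ^ (-(1:ℝ) / 4) * c x ^ ((1:ℝ) / 4) = 1 := by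
    intro x hx
    rw [← Real.rpow_add (hpos x hx)]; norm_num
  have hes : χ s - c s ^ (-(1:ℝ) / 4) * sinhInterp ε α β s t φ s = 0 := by
    have : sinhInterp ε α β s t φ s = α := by simp [sinhInterp, hsinh]
    rw [this, hα]; linear_combination -χ s * hinv s hsI
  have het : χ t - c t ^ (-(1:ℝ) / 4) * sinhInterp ε α β s t φ t = 0 := by
    have : sinhInterp ε α β s t φ t = β := by simp [sinhInterp, hsinh]
    rw [this, hβ]; linear_combination -χ t * hinv t htI
  have hampc : ContinuousOn (ampDeriv c c') (Ioo s t) := by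
    refine LipschitzOnWith.continuousOn (K := L.toNNReal) (LipschitzOnWith.of_dist_le_mul ?_)
    intro x hx y hy
    rw [Real.dist_eq, Real.dist_eq, Real.coe_toNNReal _ hL0]
    exact hL y hy x hx
  have hJc : ContinuousOn (wkbDeriv ε c c' (sinhInterp ε α β s t φ) (coshInterp ε α β s t φ))
      (Ioo s t) := by
    refine (hampc.mul fun x hx => (hSd x hx).continuousAt.continuousWithinAt).add
      (ContinuousOn.div_const (ContinuousOn.mul ?_ fun x hx =>
        (hTd x hx).continuousAt.continuousWithinAt) ε)
    exact (hcc.mono Ioo_subset_Icc_self).rpow_const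
      fun x hx => Or.inl (hpos x (Ioo_subset_Icc_self hx)).ne'
  have hec : ContinuousOn (fun x => χ x - c x ^ (-(1:ℝ) / 4) * sinhInterp ε α β s t φ x)
      (Icc s t) := by
    refine hχ.sub ((hcc.rpow_const fun x hx => Or.inl (hpos x hx).ne').mul ?_)
    refine ContinuousOn.div_const (ContinuousOn.add ?_ ?_) _ <;>
      refine continuousOn_const.mul (Real.continuous_sinh.comp_continuousOn ?_)
    · exact (continuousOn_const.sub hφ).div_const ε
    · exact (hφ.sub continuousOn_const).div_const ε
  have hχc' : ContinuousOn χ' (Ioo s t) :=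
    fun x hx => (hχd' x hx).continuousAt.continuousWithinAt
  set K := L * (2 * M ^ ((1:ℝ) / 4) * X) with hK
  have hK0 : 0 ≤ K := by positivity
  have hres := fun x (hx : x ∈ Ioo s t) =>
    hasRightResidual_sub_wkb hx hε (hpos x (Ioo_subset_Icc_self hx)) (hcd x hx)
      (hL x hx) (hSd x hx) (hTd x hx) (fun y hy => hA y (Ioo_subset_Icc_self hy)) (hχd' x hx)
  have hcτ' := fun x (hx : x ∈ Ioo s t) => hcτ x (Ioo_subset_Icc_self hx)
  have hcM' := fun x (hx : x ∈ Ioo s t) => hcM x (Ioo_subset_Icc_self hx)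
  have heD := fun x (hx : x ∈ Ioo s t) => (hχd x hx).sub (hJd x hx)
  refine ⟨_, hJc, hJd, fun x hx => ?_, fun x hx => ?_⟩
  · refine (abs_le_of_hasRightResidual hε hτ hK0 hec hes het heD hcτ' hres x hx).trans ?_
    rw [show 2 * L * M ^ ((1:ℝ) / 4) * ((M + 2) * (1 + 1 / τ) + 1) * X =
      K * ((M + 2) * (1 + 1 / τ) + 1) by rw [hK]; ring]
    refine mul_le_mul_of_nonneg_right (mul_le_mul_of_nonneg_left ?_ hK0) (sq_nonneg _)
    have : 0 ≤ 1 / τ := by positivity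
    nlinarith [mul_nonneg hM.le this]
  · refine (abs_deriv_le_of_hasRightResidual hε hτ hK0 hec hes het heD (hχc'.sub hJc) hcτ' hcM'
      hres x hx).trans (le_of_eq ?_)
    rw [hK]; ring

/-- Lipschitz continuity of the derivative of `c ^ (-1/4)` for `c` in `W^{2,∞}`. -/
lemma exists_lipschitz_ampDeriv {s t τ : ℝ} {c c' : ℝ → ℝ} (hτ : 0 < τ)
    (hc : ∀ x ∈ Icc s t, HasDerivWithinAt c (c' x) (Icc s t) x)
    (hc' : ∃ K, LipschitzOnWith K c' (Icc s t)) (hcτ : ∀ x ∈ Icc s t, τ ≤ c x) :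
    ∃ L, 0 ≤ L ∧ ∀ x ∈ Icc s t, ∀ y ∈ Icc s t,
      |ampDeriv c c' y - ampDeriv c c' x| ≤ L * |y - x| := by
  obtain ⟨K, hK⟩ := hc'
  have hcc : ContinuousOn c (Icc s t) := fun x hx => (hc x hx).continuousWithinAt
  have hne : ∀ x ∈ Icc s t, c x ≠ 0 := fun x hx => (hτ.trans_le (hcτ x hx)).ne'
  have hrc : ∀ q : ℝ, ContinuousOn (fun x => c x ^ q) (Icc s t) :=
    fun q => hcc.rpow_const fun x hx => Or.inl (hne x hx)
  obtain ⟨B₁, hB₁⟩ := isCompact_Icc.exists_bound_of_continuousOn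
    ((hK.continuousOn.mul continuousOn_const).mul (hrc (-(5:ℝ) / 4 - 1)) :
      ContinuousOn (fun x => c' x * (-(5:ℝ) / 4) * c x ^ (-(5:ℝ) / 4 - 1)) (Icc s t))
  obtain ⟨B₂, hB₂⟩ := isCompact_Icc.exists_bound_of_continuousOn (hrc (-(5:ℝ) / 4))
  obtain ⟨B₃, hB₃⟩ := isCompact_Icc.exists_bound_of_continuousOn hK.continuousOn
  refine ⟨1 / 4 * (|B₂| * K + |B₃| * |B₁|), by positivity, fun x hx y hy => ?_⟩
  have h1 : |c y ^ (-(5:ℝ) / 4) - c x ^ (-(5:ℝ) / 4)| ≤ |B₁| * |y - x| := by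
    refine (Convex.norm_image_sub_le_of_norm_hasDerivWithin_le
      (fun z hz => (hc z hz).rpow_const (Or.inl (hne z hz))) hB₁ (convex_Icc s t) hx hy).trans ?_
    rw [Real.norm_eq_abs]
    gcongr
    exact le_abs_self _
  have h2 : |c' y - c' x| ≤ K * |y - x| := by simpa [Real.dist_eq] using hK.dist_le_mul y hy x hx
  have h3 : |c y ^ (-(5:ℝ) / 4)| ≤ |B₂| := (hB₂ y hy).trans (le_abs_self _)
  have h4 : |c' x| ≤ |B₃| := (hB₃ x hx).trans (le_abs_self _)
  calc |ampDeriv c c' y - ampDeriv c c' x|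
      = 1 / 4 * |c y ^ (-(5:ℝ) / 4) * (c' y - c' x) +
          c' x * (c y ^ (-(5:ℝ) / 4) - c x ^ (-(5:ℝ) / 4))| := by
        rw [← abs_of_nonneg (by norm_num : (0:ℝ) ≤ 1 / 4), ← abs_mul, ← abs_neg]
        congr 1
        simp only [ampDeriv]
        ring
    _ ≤ 1 / 4 * (|B₂| * (K * |y - x|) + |B₃| * (|B₁| * |y - x|)) := by
        gcongr
        refine (abs_add_le _ _).trans ?_
        rw [abs_mul, abs_mul]
        gcongr
    _ = 1 / 4 * (|B₂| * K + |B₃| * |B₁|) * |y - x| := by ring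

section Grid

variable {p : ℕ → ℝ} {N : ℕ}

lemma grid_strictMono (hp : ∀ n, 1 ≤ n → n < N → p n < p (n + 1)) :
    StrictMonoOn p (Icc 1 N) := by
  intro i hi j hj hij
  induction j, Nat.succ_le_of_lt hij using Nat.le_induction with
  | base => exact hp i hi.1 (lt_of_lt_of_le (Nat.lt_succ_self i) hj.2)
  | succ j hij' ih =>
    have hj' : j ∈ Icc 1 N := ⟨hi.1.trans (Nat.le_of_succ_le hij'), (Nat.le_succ j).trans hj.2⟩
    exact (ih hj' hij').trans (hp j hj'.1 hj.2)

lemma exists_grid_eq_or_mem_cell {t : ℝ} (h1 : p 1 ≤ t) {k : ℕ} (hk : 1 ≤ k) (hkt : t ≤ p k) :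
    (∃ j, 1 ≤ j ∧ j ≤ k ∧ t = p j) ∨ ∃ m, 1 ≤ m ∧ m < k ∧ t ∈ Ioo (p m) (p (m + 1)) := by
  induction k, hk using Nat.le_induction with
  | base => exact Or.inl ⟨1, le_rfl, le_rfl, le_antisymm hkt h1⟩
  | succ k hk ih =>
    rcases le_or_gt t (p k) with h | h
    · rcases ih h with ⟨j, hj1, hj2, hj⟩ | ⟨m, hm1, hm2, hm⟩
      · exact Or.inl ⟨j, hj1, hj2.trans (Nat.le_succ k), hj⟩
      · exact Or.inr ⟨m, hm1, hm2.trans (Nat.lt_succ_self k), hm⟩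
    · rcases hkt.eq_or_lt with h' | h'
      · exact Or.inl ⟨k + 1, Nat.le_add_left 1 k, le_rfl, h'⟩
      · exact Or.inr ⟨k, hk, Nat.lt_succ_self k, h, h'⟩

lemma integral_le_telescope {f Φ : ℝ → ℝ}
    (hf : ∀ m, 1 ≤ m → m < N → IntervalIntegrable f volume (p m) (p (m + 1)) ∧
      ∫ x in (p m)..(p (m + 1)), f x ≤ Φ (p (m + 1)) - Φ (p m)) {k : ℕ} (hk : 1 ≤ k)
    (hkN : k ≤ N) : IntervalIntegrable f volume (p 1) (p k) ∧
      ∫ x in (p 1)..(p k), f x ≤ Φ (p k) - Φ (p 1) := by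
  induction k, hk using Nat.le_induction with
  | base => simp
  | succ k hk ih =>
    obtain ⟨h1, h2⟩ := ih (Nat.le_of_succ_le hkN)
    obtain ⟨h3, h4⟩ := hf k hk hkN
    refine ⟨h1.trans h3, ?_⟩
    rw [← intervalIntegral.integral_add_adjacent_intervals h1 h3]
    linarith

lemma integral_sq_le_of_abs_le {s t B : ℝ} {f : ℝ → ℝ} (hst : s ≤ t)
    (hf : ContinuousOn f (Ioo s t)) (hB : ∀ x ∈ Ioo s t, |f x| ≤ B) :
    IntervalIntegrable (fun x => f x ^ 2) volume s t ∧
      ∫ x in s..t, f x ^ 2 ≤ (t - s) * B ^ 2 := by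
  have hsq : ∀ x ∈ Ioo s t, ‖f x ^ 2‖ ≤ B ^ 2 := by
    intro x hx
    rw [norm_pow, Real.norm_eq_abs]
    exact pow_le_pow_left₀ (abs_nonneg _) (hB x hx) 2
  constructor
  · rw [intervalIntegrable_iff_integrableOn_Ioo_of_le hst]
    refine IntegrableOn.of_bound (by simp)
      ((hf.pow 2).aestronglyMeasurable measurableSet_Ioo) (B ^ 2) ?_
    exact (ae_restrict_iff' measurableSet_Ioo).mpr (Eventually.of_forall hsq)
  · have hne : ∀ᵐ y : ℝ, y ≠ t := by simp [ae_iff]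
    have h1 := intervalIntegral.norm_integral_le_of_norm_le_const_ae (a := s) (b := t)
      (f := fun x => f x ^ 2) (C := B ^ 2) (by
        filter_upwards [hne] with y hy hyI
        rw [uIoc_of_le hst] at hyI
        exact hsq y ⟨hyI.1, lt_of_le_of_ne hyI.2 hy⟩)
    rw [abs_of_nonneg (sub_nonneg.mpr hst), mul_comm] at h1
    exact (le_abs_self _).trans h1

lemma integral_sq_le_of_cell_bounds {f w Φ : ℝ → ℝ} {B τ : ℝ} (hτ : 0 < τ) (hN : 1 ≤ N)
    (hp : ∀ n, 1 ≤ n → n < N → p n < p (n + 1))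
    (hf : ∀ m, 1 ≤ m → m < N → ContinuousOn f (Ioo (p m) (p (m + 1))))
    (hB : ∀ m, 1 ≤ m → m < N → ∀ x ∈ Ioo (p m) (p (m + 1)), |f x| ≤ B * |w (p (m + 1))|)
    (hΦ : ∀ m, 1 ≤ m → m < N →
      τ * ((p (m + 1) - p m) * w (p (m + 1)) ^ 2) ≤ Φ (p (m + 1)) - Φ (p m)) :
    ∫ x in (p 1)..(p N), f x ^ 2 ≤ B ^ 2 / τ * (Φ (p N) - Φ (p 1)) := by
  have := (integral_le_telescope (p := p) (N := N) (f := fun x => f x ^ 2)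
    (Φ := fun x => B ^ 2 / τ * Φ x) (fun m hm hmN => ?_) hN le_rfl).2
  · linarith
  obtain ⟨h1, h2⟩ := integral_sq_le_of_abs_le (hp m hm hmN).le (hf m hm hmN) (hB m hm hmN)
  refine ⟨h1, h2.trans ?_⟩
  calc (p (m + 1) - p m) * (B * |w (p (m + 1))|) ^ 2
      = B ^ 2 / τ * (τ * ((p (m + 1) - p m) * w (p (m + 1)) ^ 2)) := by
        rw [mul_pow, sq_abs]; field_simp
    _ ≤ B ^ 2 / τ * (Φ (p (m + 1)) - Φ (p m)) := by
        gcongr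
        exact hΦ m hm hmN
    _ = _ := by ring

variable {V : ℝ → ℝ} {E ε : ℝ}

lemma zetaHat_grid (hp : ∀ n, 1 ≤ n → n < N → p n < p (n + 1)) (hN : 2 ≤ N)
    (hV : ∀ n, 1 ≤ n → n ≤ N → 0 < V (p n) - E)
    (hγ : ∀ n, 1 ≤ n → n < N → Real.sinh (gamf V E ε p n) ≠ 0) {n k : ℕ} (hn : 1 ≤ n)
    (hnN : n ≤ N) (hk : 1 ≤ k) (hkN : k ≤ N) :
    zetaHat V E ε p N n (p k) = if n = k then 1 else 0 := by
  have hmono := grid_strictMono hp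
  have hq : ∀ i, 1 ≤ i → i ≤ N → qfun V E p i (p i) = 1 := fun i hi hiN =>
    div_self (Real.rpow_pos_of_pos (hV i hi hiN) _).ne'
  by_cases hnk : n = k
  · subst hnk
    rw [if_pos rfl]
    rcases hn.eq_or_lt with h1 | h1
    · subst h1
      have h2 : p 1 < p (1 + 1) := hp 1 le_rfl hN
      have h3 : sigf V E ε p (1 + 1) (p 1) = -gamf V E ε p 1 := by
        rw [gamf, sigf, sigf, intervalIntegral.integral_symm]; ring
      rw [zetaHat, if_neg (by simp), if_pos ⟨hN, le_rfl, h2.le⟩, wfun, hq 1 le_rfl hkN, h3,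
        Real.sinh_neg, neg_div, div_self (hγ 1 le_rfl hN)]
      norm_num
    · obtain ⟨j, rfl⟩ : ∃ j, n = j + 1 := ⟨n - 1, by omega⟩
      have hj : 1 ≤ j := by omega
      rw [zetaHat, if_pos ⟨h1, by simpa using (hp j hj hkN).le, le_rfl⟩, Nat.add_sub_cancel, vfun,
        hq _ hk hkN, ← gamf, div_self (hγ j hj hkN), one_mul]
  · rw [if_neg hnk, zetaHat]
    split_ifs with h1 h2
    · obtain ⟨h3, h4, h5⟩ := h1
      have h6 := (hmono.le_iff_le (a := n - 1) (b := k) ⟨by omega, by omega⟩ ⟨hk, hkN⟩).mp h4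
      have h7 := (hmono.le_iff_le (a := k) (b := n) ⟨hk, hkN⟩ ⟨hn, hnN⟩).mp h5
      obtain rfl : k = n - 1 := by omega
      simp [vfun, sigf]
    · obtain ⟨h3, h4, h5⟩ := h2
      have h6 := (hmono.le_iff_le (a := n) (b := k) ⟨hn, hnN⟩ ⟨hk, hkN⟩).mp h4
      have h7 := (hmono.le_iff_le (a := k) (b := n + 1) ⟨hk, hkN⟩ ⟨by omega, by omega⟩).mp h5
      obtain rfl : k = n + 1 := by omega
      simp [wfun, sigf]
    · rfl

lemma zetaHat_cell (hp : ∀ n, 1 ≤ n → n < N → p n < p (n + 1)) {m : ℕ} (hm : 1 ≤ m) (hmN : m < N)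
    {t : ℝ} (ht : t ∈ Ioo (p m) (p (m + 1))) {n : ℕ} (hn : 1 ≤ n) (hnN : n ≤ N) :
    zetaHat V E ε p N n t =
      (if n = m + 1 then vfun V E ε p m t else 0) + (if n = m then wfun V E ε p m t else 0) := by
  have hmono := (grid_strictMono hp).monotoneOn
  have hle : ∀ i, 1 ≤ i → i ≤ N → p i ≤ t → i ≤ m := by
    intro i hi hiN h
    by_contra! hlt
    exact absurd (h.trans_lt ht.2)
      (not_lt.mpr (hmono ⟨by omega, by omega⟩ ⟨hi, hiN⟩ (Nat.succ_le_of_lt hlt)))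
  have hge : ∀ i, 1 ≤ i → i ≤ N → t ≤ p i → m + 1 ≤ i := by
    intro i hi hiN h
    by_contra! hlt
    exact absurd (ht.1.trans_le h)
      (not_lt.mpr (hmono ⟨hi, hiN⟩ ⟨hm, hmN.le⟩ (Nat.lt_succ_iff.mp hlt)))
  rw [zetaHat]
  by_cases h1 : n = m + 1
  · subst h1
    rw [if_pos ⟨by omega, by simpa using ht.1.le, ht.2.le⟩]
    simp
  by_cases h2 : n = m
  · subst h2
    rw [if_neg, if_pos ⟨hmN, ht.1.le, ht.2.le⟩]
    · simp
    · rintro ⟨h3, h4, h5⟩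
      exact absurd (ht.1.trans_le h5) (lt_irrefl _)
  · rw [if_neg h1, if_neg h2, if_neg, if_neg, add_zero]
    · rintro ⟨h3, h4, h5⟩
      have := hle n hn hnN h4
      have := hge (n + 1) (by omega) (by omega) h5
      omega
    · rintro ⟨h3, h4, h5⟩
      have := hle (n - 1) (by omega) (by omega) h4
      have := hge n hn hnN h5
      omega

lemma sum_zetaHat_grid (hp : ∀ n, 1 ≤ n → n < N → p n < p (n + 1)) (hN : 2 ≤ N)
    (hV : ∀ n, 1 ≤ n → n ≤ N → 0 < V (p n) - E)
    (hγ : ∀ n, 1 ≤ n → n < N → Real.sinh (gamf V E ε p n) ≠ 0) (u : ℕ → ℝ) {k : ℕ}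
    (hk : 1 ≤ k) (hkN : k ≤ N) :
    ∑ n ∈ Finset.Icc 1 N, u n * zetaHat V E ε p N n (p k) = u k := by
  have : ∀ n ∈ Finset.Icc 1 N, u n * zetaHat V E ε p N n (p k) = if n = k then u n else 0 := by
    intro n hn
    rw [Finset.mem_Icc] at hn
    rw [zetaHat_grid hp hN hV hγ hn.1 hn.2 hk hkN, mul_ite, mul_one, mul_zero]
  rw [Finset.sum_congr rfl this, Finset.sum_ite_eq', if_pos (Finset.mem_Icc.mpr ⟨hk, hkN⟩)]

lemma sum_zetaHat_cell (hp : ∀ n, 1 ≤ n → n < N → p n < p (n + 1)) {m : ℕ} (hm : 1 ≤ m)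
    (hmN : m < N) {t : ℝ} (ht : t ∈ Ioo (p m) (p (m + 1))) (u : ℕ → ℝ) :
    ∑ n ∈ Finset.Icc 1 N, u n * zetaHat V E ε p N n t =
      u (m + 1) * vfun V E ε p m t + u m * wfun V E ε p m t := by
  have : ∀ n ∈ Finset.Icc 1 N, u n * zetaHat V E ε p N n t =
      (if n = m + 1 then u n * vfun V E ε p m t else 0) +
        (if n = m then u n * wfun V E ε p m t else 0) := by
    intro n hn
    rw [Finset.mem_Icc] at hn
    rw [zetaHat_cell hp hm hmN ht hn.1 hn.2, mul_add, mul_ite, mul_ite, mul_zero]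
  rw [Finset.sum_congr rfl this, Finset.sum_add_distrib, Finset.sum_ite_eq', Finset.sum_ite_eq',
    if_pos (Finset.mem_Icc.mpr ⟨by omega, by omega⟩), if_pos (Finset.mem_Icc.mpr ⟨hm, hmN.le⟩)]

/-- On a grid cell the WKB interpolant is `(V - E) ^ (-1/4)` times a `sinhInterp`. -/
lemma vfun_add_wfun_eq {φ : ℝ → ℝ} {m : ℕ} {t a b : ℝ} (ht : 0 < V t - E)
    (hσ : ∀ n, n = m ∨ n = m + 1 → ∀ x, x = t ∨ x = p (m + 1) →
      sigf V E ε p n x = (φ x - φ (p n)) / ε) :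
    b * vfun V E ε p m t + a * wfun V E ε p m t =
      (V t - E) ^ (-(1:ℝ) / 4) * sinhInterp ε (a * (V (p m) - E) ^ ((1:ℝ) / 4))
        (b * (V (p (m + 1)) - E) ^ ((1:ℝ) / 4)) (p m) (p (m + 1)) φ t := by
  have hinv : (V t - E) ^ (-(1:ℝ) / 4) = ((V t - E) ^ ((1:ℝ) / 4))⁻¹ := by
    rw [← Real.rpow_neg ht.le]; norm_num
  have hswap : (φ t - φ (p (m + 1))) / ε = -((φ (p (m + 1)) - φ t) / ε) := by ring
  rw [vfun, wfun, gamf, hσ m (Or.inl rfl) t (Or.inl rfl),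
    hσ (m + 1) (Or.inr rfl) t (Or.inl rfl), hσ m (Or.inl rfl) _ (Or.inr rfl), hswap,
    Real.sinh_neg, qfun, qfun, hinv, sinhInterp]
  ring

end Grid

section Scalar

variable {ε h : ℝ}

lemma min_sq_mul_add_le (hε : 0 < ε) (hh : 0 < h) : min ε h ^ 2 * (ε + h) ≤ 2 * ε * h ^ 2 := by
  rcases le_total ε h with H | H
  · rw [min_eq_left H]; nlinarith [mul_nonneg (mul_pos hε hh).le (sub_nonneg.mpr H),
      mul_nonneg (mul_pos hε hε).le (sub_nonneg.mpr H)]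
  · rw [min_eq_right H]; nlinarith [mul_nonneg (mul_pos hh hh).le (sub_nonneg.mpr H)]

lemma rpow_three_halves {x : ℝ} (hx : 0 < x) : x ^ ((3:ℝ) / 2) = x * Real.sqrt x := by
  rw [show (3:ℝ) / 2 = 1 + 1 / 2 by norm_num, Real.rpow_add hx, Real.rpow_one, Real.sqrt_eq_rpow]

lemma min_le_sqrt_mul_min (hε : 0 < ε) (hh : 0 < h) :
    min ε h ≤ Real.sqrt h * min (Real.sqrt ε) (Real.sqrt h) := by
  have h0 : 0 ≤ min ε h := le_min hε.le hh.le
  calc min ε h = Real.sqrt (min ε h) * Real.sqrt (min ε h) := (Real.mul_self_sqrt h0).symm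
    _ ≤ _ := mul_le_mul (Real.sqrt_le_sqrt (min_le_right _ _))
        (le_min (Real.sqrt_le_sqrt (min_le_left _ _)) (Real.sqrt_le_sqrt (min_le_right _ _)))
        (Real.sqrt_nonneg _) (Real.sqrt_nonneg _)

lemma min_sq_le_sqrt_mul_min (hε : 0 < ε) (hh : 0 < h) :
    min ε h ^ 2 ≤ Real.sqrt h * min (ε ^ ((3:ℝ) / 2)) (h ^ ((3:ℝ) / 2)) := by
  have h0 : 0 < min ε h := lt_min hε hh
  have h1 : min ε h ^ ((3:ℝ) / 2) ≤ min (ε ^ ((3:ℝ) / 2)) (h ^ ((3:ℝ) / 2)) :=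
    le_min (Real.rpow_le_rpow h0.le (min_le_left _ _) (by norm_num))
      (Real.rpow_le_rpow h0.le (min_le_right _ _) (by norm_num))
  calc min ε h ^ 2 = Real.sqrt (min ε h) * min ε h ^ ((3:ℝ) / 2) := by
        rw [rpow_three_halves h0]
        nlinarith [Real.mul_self_sqrt h0.le]
    _ ≤ _ := by
        gcongr
        exact min_le_right _ _

end Scalar

lemma bounds_Icc_of_Ioo {s t a b : ℝ} {c : ℝ → ℝ} (hst : s < t) (hc : ContinuousOn c (Icc s t))
    (h : ∀ x ∈ Ioo s t, a ≤ c x ∧ c x ≤ b) : ∀ x ∈ Icc s t, a ≤ c x ∧ c x ≤ b := by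
  intro x hx
  have h1 : MapsTo c (Ioo s t) (Icc a b) := h
  have h2 := h1.closure_of_continuousOn (by rwa [closure_Ioo hst.ne])
  rw [closure_Ioo hst.ne, isClosed_Icc.closure_eq] at h2
  exact h2 hx

/-- **Lemma 3.2 (consistency / interpolation error of the WKB-FEM)**: under Hypothesis A,
the interpolation error `e¹_h = χ_ex − Π_h^ε χ_ex` of the exact solution `χ_ex` of the
evanescent BVP in the WKB hat-function space satisfies `ε`- and `h`-uniform estimates. -/
theorem WKB_FEM_interpolation_error (x_d : ℝ) (hxd : 0 < x_d)
    (V V' : ℝ → ℝ) (E τev Mev : ℝ)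
    (hV : ∀ x ∈ Icc 0 x_d, HasDerivWithinAt V (V' x) (Icc 0 x_d) x)
    (hVlip : ∃ K, LipschitzOnWith K V' (Icc 0 x_d))
    (hE : 0 < E) (hτ : 0 < τev)
    (hbound : ∀ x ∈ Ioo 0 x_d, τev ≤ V x - E ∧ V x - E ≤ Mev) :
    ∃ C : ℝ, 0 < C ∧ ∀ ε : ℝ, ε ∈ Ioo (0:ℝ) 1 →
      ∀ N : ℕ, 2 ≤ N → ∀ p : ℕ → ℝ, p 1 = 0 → p N = x_d →
      (∀ n, 1 ≤ n → n < N → p n < p (n + 1)) →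
      ∀ h : ℝ, (∀ n, 1 ≤ n → n < N → p (n + 1) - p n ≤ h) →
      -- χ : the exact solution of the evanescent-region BVP
      ∀ χ χ' : ℝ → ℝ,
        IsSchroSolR ε (fun x => E - V x) 0 x_d χ χ' →
        ε * χ' 0 - Real.sqrt (V 0 - E) * χ 0 = 0 →
        ε * χ' x_d = 1 →
      -- DInterp : the derivative of the interpolant Π_h^ε χ on the open grid cells
      ∀ DInterp : ℝ → ℝ,
        (∀ m, 1 ≤ m → m < N → ∀ t ∈ Ioo (p m) (p (m + 1)),
          HasDerivAt (fun s => ∑ n ∈ Finset.Icc 1 N, χ (p n) * zetaHat V E ε p N n s)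
            (DInterp t) t) →
        -- ‖e¹_h‖_{L²} ≤ C √ε h min{ε,h}
        (∫ t in (0:ℝ)..x_d,
            (χ t - ∑ n ∈ Finset.Icc 1 N, χ (p n) * zetaHat V E ε p N n t) ^ 2) ≤
          (C * Real.sqrt ε * h * min ε h) ^ 2 ∧
        -- ε‖(e¹_h)'‖_{L²} ≤ C ε^{3/2} h
        ε ^ 2 * (∫ t in (0:ℝ)..x_d, (χ' t - DInterp t) ^ 2) ≤ (C * ε ^ ((3:ℝ)/2) * h) ^ 2 ∧
        -- ‖e¹_h‖_{C[0,x_d]} ≤ C √h min{ε^{3/2},h^{3/2}}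
        (∀ t ∈ Icc 0 x_d,
          |χ t - ∑ n ∈ Finset.Icc 1 N, χ (p n) * zetaHat V E ε p N n t| ≤
            C * Real.sqrt h * min (ε ^ ((3:ℝ)/2)) (h ^ ((3:ℝ)/2))) ∧
        -- ε‖(e¹_h)'‖_{L∞} ≤ C ε √h min{√ε,√h}
        (∀ m, 1 ≤ m → m < N → ∀ t ∈ Ioo (p m) (p (m + 1)),
          ε * |χ' t - DInterp t| ≤
            C * ε * Real.sqrt h * min (Real.sqrt ε) (Real.sqrt h)) := by

  have hV' : ∀ x ∈ Icc 0 x_d, HasDerivWithinAt (fun y => V y - E) (V' x) (Icc 0 x_d) x :=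
    fun x hx => (hV x hx).sub_const E
  have hcc : ContinuousOn (fun y => V y - E) (Icc 0 x_d) :=
    fun x hx => (hV' x hx).continuousWithinAt
  have hcb := bounds_Icc_of_Ioo hxd hcc hbound
  have hcpos : ∀ x ∈ Icc 0 x_d, 0 < V x - E := fun x hx => hτ.trans_le (hcb x hx).1
  have h0I : (0:ℝ) ∈ Icc 0 x_d := left_mem_Icc.mpr hxd.le
  have hdI : x_d ∈ Icc 0 x_d := right_mem_Icc.mpr hxd.le
  have hM : 0 < Mev := (hcpos 0 h0I).trans_le (hcb 0 h0I).2
  obtain ⟨L, hL0, hL⟩ := exists_lipschitz_ampDeriv hτ hV' hVlip fun x hx => (hcb x hx).1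
  obtain ⟨φ, hφ⟩ : ∃ φ : ℝ → ℝ, φ = fun x => ∫ y in (0:ℝ)..x, Real.sqrt (V y - E) := ⟨_, rfl⟩
  have hsq : ContinuousOn (fun y => Real.sqrt (V y - E)) (Icc 0 x_d) := hcc.sqrt
  have hsqi : ∀ x ∈ Icc 0 x_d,
      IntervalIntegrable (fun y => Real.sqrt (V y - E)) volume 0 x := by
    intro x hx
    refine (hsq.mono ?_).intervalIntegrable
    rw [uIcc_of_le hx.1]
    exact Icc_subset_Icc_right hx.2
  have hφc : ContinuousOn φ (Icc 0 x_d) := by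
    have := continuousOn_primitive_interval' (hsqi x_d hdI) left_mem_uIcc
    rwa [uIcc_of_le hxd.le, ← hφ] at this
  have hφd : ∀ x ∈ Ioo 0 x_d, HasDerivAt φ (Real.sqrt (V x - E)) x := by
    intro x hx
    rw [hφ]
    exact integral_hasDerivAt_right (hsqi x (Ioo_subset_Icc_self hx))
      ((hsq.mono Ioo_subset_Icc_self).stronglyMeasurableAtFilter isOpen_Ioo x hx)
      (hsq.continuousAt (Icc_mem_nhds hx.1 hx.2))
  have hφm : StrictMonoOn φ (Icc 0 x_d) := by
    refine strictMonoOn_of_deriv_pos (convex_Icc 0 x_d) hφc fun x hx => ?_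
    rw [interior_Icc] at hx
    rw [(hφd x hx).deriv]
    exact Real.sqrt_pos.mpr (hcpos x (Ioo_subset_Icc_self hx))
  set R := 1 + 1 / Real.sqrt τev with hR
  have hsτ : 0 < Real.sqrt τev := Real.sqrt_pos.mpr hτ
  have hR1 : 1 ≤ R := le_add_of_nonneg_right (by positivity)
  have hRτ : 1 / Real.sqrt τev ≤ R := by linarith
  have hRτ2 : 1 / τev ≤ R ^ 2 := by
    calc 1 / τev = (1 / Real.sqrt τev) ^ 2 := by rw [div_pow, Real.sq_sqrt hτ.le, one_pow]
      _ ≤ R ^ 2 := by gcongr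
  set C₀ := 2 * L * Mev ^ ((1:ℝ) / 4) * ((Mev + 2) * (1 + 1 / τev) + 1) with hC₀
  have hC₀0 : 0 ≤ C₀ := by positivity
  refine ⟨2 * (C₀ + 1) * R ^ 2, by positivity, ?_⟩
  intro ε hε N hN p hp1 hpN hp h hh χ χ' hχ hbc0 hbcd DInterp hDI
  have hε0 : 0 < ε := hε.1
  have hh0 : 0 < h := (sub_pos.mpr (hp 1 le_rfl hN)).trans_le (hh 1 le_rfl hN)
  have hmono := grid_strictMono hp
  have hpI : ∀ n, 1 ≤ n → n ≤ N → p n ∈ Icc 0 x_d := by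
    intro n hn hnN
    rw [← hp1, ← hpN]
    exact ⟨hmono.monotoneOn ⟨le_rfl, by omega⟩ ⟨hn, hnN⟩ hn,
      hmono.monotoneOn ⟨hn, hnN⟩ ⟨by omega, le_rfl⟩ hnN⟩
  have hσ : ∀ n, 1 ≤ n → n ≤ N → ∀ x ∈ Icc 0 x_d, sigf V E ε p n x = (φ x - φ (p n)) / ε := by
    intro n hn hnN x hx
    rw [sigf, hφ, intervalIntegral.integral_interval_sub_left (hsqi x hx) (hsqi _ (hpI n hn hnN))]
    ring
  have hγ : ∀ n, 1 ≤ n → n < N → Real.sinh (gamf V E ε p n) ≠ 0 := by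
    intro n hn hnN
    have hn1 := hpI (n + 1) (by omega) hnN
    rw [gamf, hσ n hn hnN.le _ hn1, Real.sinh_ne_zero]
    exact (div_pos (sub_pos.mpr (hφm (hpI n hn hnN.le) hn1 (hp n hn hnN))) hε0).ne'
  have hχc : ContinuousOn χ (Icc 0 x_d) := fun x hx => (hχ.1 x hx).continuousWithinAt
  have hχc' : ContinuousOn χ' (Icc 0 x_d) := hχ.2.1.choose_spec.continuousOn
  have hχd : ∀ x ∈ Ioo 0 x_d, HasDerivAt χ (χ' x) x :=
    fun x hx => (hχ.1 x (Ioo_subset_Icc_self hx)).hasDerivAt (Icc_mem_nhds hx.1 hx.2)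
  have hχd' : ∀ x ∈ Ioo 0 x_d, HasDerivAt χ' ((V x - E) * χ x / ε ^ 2) x := by
    intro x hx
    convert! hχ.hasDerivAt_deriv hε0
      ((hcc.neg).congr fun y _ => by simp : ContinuousOn (fun y => E - V y) (Icc 0 x_d)) x hx using 1
    ring
  obtain ⟨hsqm, hend, hstart, henergy⟩ := evanescent_energy (c := fun x => V x - E) hε0 hτ hxd hχc
    hχc' hχd hχd' (fun x hx => (hcb x hx).1) hbc0 hbcd
  have hend' : |χ x_d| ≤ 1 / Real.sqrt τev := by
    rw [le_div_iff₀ hsτ, ← abs_of_pos hsτ, ← abs_mul, ← sq_le_one_iff_abs_le_one, mul_pow,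
      Real.sq_sqrt hτ.le, mul_comm]
    exact hend
  have hχR : ∀ x ∈ Icc 0 x_d, |χ x| ≤ R := fun x hx =>
    (sq_le_sq.mp (hsqm hx hdI hx.2)).trans (hend'.trans hRτ)
  set μ := min ε h with hμ
  have hμ0 : 0 < μ := lt_min hε0 hh0
  set e := fun t => χ t - ∑ n ∈ Finset.Icc 1 N, χ (p n) * zetaHat V E ε p N n t with he
  have hgrid : ∀ k, 1 ≤ k → k ≤ N → e (p k) = 0 := by
    intro k hk hkN
    rw [he]
    simp only
    rw [sum_zetaHat_grid hp hN (fun n hn hnN => hcpos _ (hpI n hn hnN)) hγ (fun n => χ (p n))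
      hk hkN, sub_self]
  have hcell : ∀ m, 1 ≤ m → m < N →
      (ContinuousOn e (Ioo (p m) (p (m + 1))) ∧
        ContinuousOn (fun t => χ' t - DInterp t) (Ioo (p m) (p (m + 1)))) ∧
      (∀ t ∈ Ioo (p m) (p (m + 1)), |e t| ≤ C₀ * μ ^ 2 * |χ (p (m + 1))|) ∧
      ∀ t ∈ Ioo (p m) (p (m + 1)), |χ' t - DInterp t| ≤ C₀ * μ * |χ (p (m + 1))| := by
    intro m hm hmN
    have hmI := hpI m hm hmN.le
    have hmI' := hpI (m + 1) (by omega) hmN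
    have hsub : Icc (p m) (p (m + 1)) ⊆ Icc 0 x_d := Icc_subset_Icc hmI.1 hmI'.2
    have hsubo : Ioo (p m) (p (m + 1)) ⊆ Ioo 0 x_d := Ioo_subset_Ioo hmI.1 hmI'.2
    have hlt := hp m hm hmN
    obtain ⟨J, hJc, hJd, hJe, hJe'⟩ := wkb_cell_estimate (c := fun x => V x - E) (c' := V')
      (X := |χ (p (m + 1))|) hε0 hlt hτ hL0 (hcc.mono hsub)
      (fun x hx => (hV' x (Ioo_subset_Icc_self (hsubo hx))).hasDerivAt
        (Icc_mem_nhds (hsubo hx).1 (hsubo hx).2))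
      (fun x hx y hy => hL x (Ioo_subset_Icc_self (hsubo hx)) y (Ioo_subset_Icc_self (hsubo hy)))
      (fun x hx => (hcb x (hsub hx)).1) (fun x hx => (hcb x (hsub hx)).2) (hφc.mono hsub)
      (fun x hx => hφd x (hsubo hx)) (hχc.mono hsub) (fun x hx => hχd x (hsubo hx))
      (fun x hx => hχd' x (hsubo hx)) (sq_le_sq.mp (hsqm hmI hmI' hlt.le)) le_rfl
    have hsum : ∀ t ∈ Ioo (p m) (p (m + 1)),
        ∑ n ∈ Finset.Icc 1 N, χ (p n) * zetaHat V E ε p N n t =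
          (V t - E) ^ (-(1:ℝ) / 4) * sinhInterp ε (χ (p m) * (V (p m) - E) ^ ((1:ℝ) / 4))
            (χ (p (m + 1)) * (V (p (m + 1)) - E) ^ ((1:ℝ) / 4)) (p m) (p (m + 1)) φ t := by
      intro t ht
      have htI := Ioo_subset_Icc_self (hsubo ht)
      rw [sum_zetaHat_cell hp hm hmN ht (fun n => χ (p n))]
      refine vfun_add_wfun_eq (hcpos t htI) ?_
      rintro n hn x (rfl | rfl) <;> exact hσ n (by omega) (by omega) _ (by assumption)
    have hDJ : ∀ t ∈ Ioo (p m) (p (m + 1)), DInterp t = J t := by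
      intro t ht
      refine (hDI m hm hmN t ht).unique ((hJd t ht).congr_of_eventuallyEq ?_)
      filter_upwards [Ioo_mem_nhds ht.1 ht.2] with y hy using hsum y hy
    have hec : ContinuousOn e (Ioo (p m) (p (m + 1))) := by
      refine (hχc.mono (hsubo.trans Ioo_subset_Icc_self)).sub ?_
      exact ContinuousOn.congr (fun t ht => (hJd t ht).continuousAt.continuousWithinAt) hsum
    have hminμ : min ε (p (m + 1) - p m) ≤ μ := min_le_min_left _ (hh m hm hmN)
    have hmin0 : 0 < min ε (p (m + 1) - p m) := lt_min hε0 (sub_pos.mpr hlt)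
    refine ⟨⟨hec, ?_⟩, fun t ht => ?_, fun t ht => ?_⟩
    · exact (hχc'.mono (hsubo.trans Ioo_subset_Icc_self)).sub (hJc.congr hDJ)
    · rw [he]
      simp only
      rw [hsum t ht]
      refine (hJe t (Ioo_subset_Icc_self ht)).trans ?_
      rw [← hC₀, mul_right_comm]
      gcongr
    · rw [hDJ t ht]
      refine (hJe' t ht).trans ?_
      rw [← hC₀, mul_right_comm]
      gcongr
  set Φ := fun x => ε ^ 2 * (χ x * χ' x) + τev * h * χ x ^ 2 with hΦdef
  have hΦ : ∀ m, 1 ≤ m → m < N →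
      τev * ((p (m + 1) - p m) * χ (p (m + 1)) ^ 2) ≤ Φ (p (m + 1)) - Φ (p m) := by
    intro m hm hmN
    have hmI := hpI m hm hmN.le
    have hmI' := hpI (m + 1) (by omega) hmN
    have hlt := hp m hm hmN
    have h1 := henergy _ hmI _ hmI' hlt.le
    have h2 : χ (p m) ^ 2 ≤ χ (p (m + 1)) ^ 2 := hsqm hmI hmI' hlt.le
    have h3 := mul_le_mul_of_nonneg_left (mul_le_mul_of_nonneg_right (hh m hm hmN)
      (sub_nonneg.mpr h2)) hτ.le
    simp only [hΦdef]
    linarith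
  have hΦtot : Φ (p N) - Φ (p 1) ≤ R * (ε + h) := by
    have h1 : 0 ≤ Φ (p 1) := by rw [hp1]; simp only [hΦdef]; positivity
    have h2 : Φ (p N) = ε * χ x_d + h * (τev * χ x_d ^ 2) := by
      rw [hpN]; simp only [hΦdef]; linear_combination ε * χ x_d * hbcd
    have h3 : ε * χ x_d ≤ ε * R := by gcongr; exact (le_abs_self _).trans (hχR _ hdI)
    have h4 : h * (τev * χ x_d ^ 2) ≤ h * R := by gcongr; exact hend.trans hR1
    linarith
  have hL2 : ∀ f : ℝ → ℝ, ∀ ρ : ℝ, 0 ≤ ρ →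
      (∀ m, 1 ≤ m → m < N → ContinuousOn f (Ioo (p m) (p (m + 1)))) →
      (∀ m, 1 ≤ m → m < N → ∀ t ∈ Ioo (p m) (p (m + 1)),
        |f t| ≤ C₀ * (ρ * μ) * |χ (p (m + 1))|) →
      ∫ t in (0:ℝ)..x_d, f t ^ 2 ≤ (2 * (C₀ + 1) * R ^ 2) ^ 2 * (ρ ^ 2 * ε * h ^ 2) := by
    intro f ρ hρ hfc hfb
    have h1 := integral_sq_le_of_cell_bounds hτ (by omega) hp hfc hfb hΦ
    rw [hp1, hpN] at h1
    rw [hp1, hpN] at hΦtot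
    calc _ ≤ (C₀ * (ρ * μ)) ^ 2 / τev * (R * (ε + h)) :=
          h1.trans (mul_le_mul_of_nonneg_left hΦtot (by positivity))
      _ = C₀ ^ 2 * R * (1 / τev) * ρ ^ 2 * (μ ^ 2 * (ε + h)) := by ring
      _ ≤ (C₀ + 1) ^ 2 * R ^ 2 * R ^ 2 * ρ ^ 2 * (2 * ε * h ^ 2) := by
          refine mul_le_mul ?_ (min_sq_mul_add_le hε0 hh0) (by positivity) (by positivity)
          gcongr
          · linarith
          · exact le_self_pow₀ hR1 two_ne_zero
      _ ≤ (2 * (C₀ + 1) * R ^ 2) ^ 2 * (ρ ^ 2 * ε * h ^ 2) := by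
          have : 0 ≤ (C₀ + 1) ^ 2 * R ^ 2 * R ^ 2 * ρ ^ 2 * (ε * h ^ 2) := by positivity
          linarith
  have hCbd : ∀ x ∈ Icc 0 x_d, C₀ * |χ x| ≤ 2 * (C₀ + 1) * R ^ 2 := by
    intro x hx
    calc C₀ * |χ x| ≤ (C₀ + 1) * R ^ 2 := by
          gcongr
          · linarith
          · exact (hχR x hx).trans (le_self_pow₀ hR1 two_ne_zero)
      _ ≤ 2 * (C₀ + 1) * R ^ 2 := by
          have : 0 ≤ (C₀ + 1) * R ^ 2 := by positivity
          linarith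
  refine ⟨?_, ?_, ?_, ?_⟩
  · refine (hL2 e μ hμ0.le (fun m hm hmN => (hcell m hm hmN).1.1) fun m hm hmN t ht => ?_).trans
      (le_of_eq ?_)
    · rw [← pow_two]; exact (hcell m hm hmN).2.1 t ht
    · linear_combination
        -((2 * (C₀ + 1) * R ^ 2) ^ 2 * μ ^ 2 * h ^ 2) * Real.sq_sqrt hε0.le
  · have h1 := hL2 (fun t => χ' t - DInterp t) 1 zero_le_one
      (fun m hm hmN => (hcell m hm hmN).1.2)
      fun m hm hmN t ht => by rw [one_mul]; exact (hcell m hm hmN).2.2 t ht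
    refine (mul_le_mul_of_nonneg_left h1 (sq_nonneg ε)).trans (le_of_eq ?_)
    rw [rpow_three_halves hε0]
    linear_combination
      -((2 * (C₀ + 1) * R ^ 2) ^ 2 * ε ^ 2 * h ^ 2) * Real.sq_sqrt hε0.le
  · intro t ht
    have hC : 0 ≤ 2 * (C₀ + 1) * R ^ 2 := by positivity
    change |e t| ≤ _
    rw [mul_assoc]
    refine le_trans ?_ (mul_le_mul_of_nonneg_left (min_sq_le_sqrt_mul_min hε0 hh0) hC)
    rw [← hp1, ← hpN] at ht
    rcases exists_grid_eq_or_mem_cell ht.1 (by omega) ht.2 with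
      ⟨j, hj1, hj2, rfl⟩ | ⟨m, hm1, hm2, hm⟩
    · rw [hgrid j hj1 hj2, abs_zero]; positivity
    · refine ((hcell m hm1 hm2).2.1 t hm).trans ?_
      rw [mul_right_comm]
      exact mul_le_mul_of_nonneg_right (hCbd _ (hpI (m + 1) (by omega) hm2)) (sq_nonneg _)
  · intro m hm hmN t ht
    have hC : 0 ≤ 2 * (C₀ + 1) * R ^ 2 := by positivity
    have h1 : |χ' t - DInterp t| ≤ 2 * (C₀ + 1) * R ^ 2 *
        (Real.sqrt h * min (Real.sqrt ε) (Real.sqrt h)) := by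
      refine ((hcell m hm hmN).2.2 t ht).trans ?_
      rw [mul_right_comm]
      exact mul_le_mul (hCbd _ (hpI (m + 1) (by omega) hmN)) (min_le_sqrt_mul_min hε0 hh0)
        hμ0.le hC
    calc ε * |χ' t - DInterp t| ≤ ε * (2 * (C₀ + 1) * R ^ 2 *
          (Real.sqrt h * min (Real.sqrt ε) (Real.sqrt h))) := by gcongr
      _ = _ := by ring
end
end
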